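/- arXiv:1212.0251 — 4 statements merged into one kernel-verified Lean document; each statement's English description precedes it below -/
import Mathlib

section
/- The Appell function satisfies F_1(2/3; 1/2, 1/2; 5/3 | −2, −8) = Γ(1/3)^3 / (3 · 16^{1/3} · √3 · π). Equivalently, (2/3) ∫_0^1 u^{−1/3} ((1+2u)(1+8u))^{−1/2} du = Γ(1/3)^3 / (3 · 16^{1/3} · √3 · π). -/
open MeasureTheory

noncomputable def lauricellaFD (n : ℕ) (a : ℂ) (b : Fin n → ℂ) (c : ℂ) (x : Fin n → ℂ) : ℂ :=
  (Complex.Gamma c / (Complex.Gamma a * Complex.Gamma (c - a))) *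
    ∫ u in (0:ℝ)..1, (u : ℂ) ^ (a - 1) * ((1 : ℂ) - u) ^ (c - a - 1) *
      ∏ k, ((1 : ℂ) - x k * u) ^ (-(b k))

noncomputable def appellF1 (a b₁ b₂ c x₁ x₂ : ℂ) : ℂ :=
  lauricellaFD 2 a ![b₁, b₂] c ![x₁, x₂]

noncomputable def ellipticK (k : ℝ) : ℝ :=
  ∫ θ in (0:ℝ)..(Real.pi/2), (1 - k ^ 2 * Real.sin θ ^ 2) ^ (-(1:ℝ)/2)

theorem Real.integral_rpow_mul_one_sub_rpow {a b : ℝ} (ha : 0 < a) (hb : 0 < b) :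
    ∫ x in (0:ℝ)..1, x ^ (a - 1) * (1 - x) ^ (b - 1) = ProbabilityTheory.beta a b := by
  rw [ProbabilityTheory.beta_eq_betaIntegralReal a b ha hb, Complex.betaIntegral,
    ← Complex.ofReal_re (∫ x in (0:ℝ)..1, x ^ (a - 1) * (1 - x) ^ (b - 1)),
    ← intervalIntegral.integral_ofReal]
  congr 1
  refine intervalIntegral.integral_congr fun x hx ↦ ?_
  rw [Set.uIcc_of_le zero_le_one] at hx
  push_cast [Complex.ofReal_cpow hx.1, Complex.ofReal_cpow (sub_nonneg.2 hx.2)]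
  rfl

theorem beta_one_third_one_half :
    ProbabilityTheory.beta (1/3) (1/2) =
      √3 * Real.Gamma (1/3) ^ 3 / (2 * (2:ℝ) ^ ((1:ℝ)/3) * Real.pi) := by
  have h₁ := Real.Gamma_mul_Gamma_one_sub (1/3)
  have h₂ := Real.Gamma_mul_Gamma_add_half (1/3)
  rw [show Real.pi * (1/3) = Real.pi / 3 by ring, Real.sin_pi_div_three] at h₁
  norm_num at h₁ h₂
  have hg₁ : 0 < Real.Gamma (1/3) := Real.Gamma_pos_of_pos (by norm_num)
  have hg₂ : 0 < Real.Gamma (2/3) := Real.Gamma_pos_of_pos (by norm_num)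
  have hg₅ : 0 < Real.Gamma (5/6) := Real.Gamma_pos_of_pos (by norm_num)
  have hp : 0 < (2:ℝ) ^ ((1:ℝ)/3) := by positivity
  have h3 : 0 < √(3:ℝ) := by positivity
  have hpi := Real.pi_pos
  rw [ProbabilityTheory.beta, Real.Gamma_one_half_eq, show (1:ℝ)/3 + 1/2 = 5/6 by norm_num]
  set g₁ := Real.Gamma (1/3)
  set g₂ := Real.Gamma (2/3)
  set g₅ := Real.Gamma (5/6)
  set p := (2:ℝ) ^ ((1:ℝ)/3)
  rw [div_eq_div_iff hg₅.ne' (by positivity)]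
  field_simp at h₁
  have h₁' : g₁ * g₂ * √3 = 2 * Real.pi := by linarith
  linear_combination (-√3 * g₁ ^ 2) * h₂ - g₁ * p * √Real.pi * h₁'

theorem integral_rpow_mul_appell_weight :
    ∫ u in (0:ℝ)..1, u ^ (-(1:ℝ)/3) * ((1 + 2*u) * (1 + 8*u)) ^ (-(1:ℝ)/2) =
      ProbabilityTheory.beta (1/3) (1/2) / 6 := by
  let f : ℝ → ℝ := fun u ↦ 27 * u ^ 2 / (1 + 2 * u) ^ 3
  let f' : ℝ → ℝ := fun u ↦ 54 * u * (1 - u) / (1 + 2 * u) ^ 4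
  have hf : ContinuousOn f (Set.Icc 0 1) := by
    refine ContinuousOn.div (by fun_prop) (by fun_prop) fun u hu ↦ ?_
    have := hu.1
    positivity
  have hff' : ∀ u ∈ Set.Ioo (0:ℝ) 1, HasDerivAt f (f' u) u := by
    intro u hu
    have h0 : (0:ℝ) < 1 + 2 * u := by linarith [hu.1]
    have h1 : HasDerivAt (fun u : ℝ ↦ 27 * u ^ 2) (27 * (2 * u)) u := by
      simpa using (hasDerivAt_pow 2 u).const_mul 27
    have h2 : HasDerivAt (fun u : ℝ ↦ (1 + 2 * u) ^ 3) (3 * (1 + 2 * u) ^ 2 * 2) u := by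
      simpa using (((hasDerivAt_id u).const_mul 2).const_add 1).fun_pow 3
    refine (h1.div h2 (by positivity)).congr_deriv ?_
    simp only [f']
    field_simp
    ring
  have hf' : ∀ u ∈ Set.Ioo (0:ℝ) 1, 0 ≤ f' u := by
    intro u hu
    have := hu.1
    have := sub_pos.2 hu.2
    positivity
  have key := integral_Icc_deriv_smul_of_deriv_nonneg
    (g := fun x : ℝ ↦ x ^ ((1:ℝ)/3 - 1) * (1 - x) ^ ((1:ℝ)/2 - 1)) hf hff' hf' zero_le_one
  have hf0 : f 0 = 0 := by norm_num [f]
  have hf1 : f 1 = 1 := by norm_num [f]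
  rw [hf0, hf1, integral_Icc_eq_integral_Ioc, integral_Icc_eq_integral_Ioc,
    ← intervalIntegral.integral_of_le zero_le_one, ← intervalIntegral.integral_of_le zero_le_one,
    Real.integral_rpow_mul_one_sub_rpow (by norm_num) (by norm_num)] at key
  rw [← key, eq_div_iff (by norm_num), ← intervalIntegral.integral_mul_const]
  refine intervalIntegral.integral_congr_Ioo_of_le zero_le_one fun u hu ↦ ?_
  obtain ⟨hu0, hu1⟩ := hu
  have hv : 0 < 1 - u := sub_pos.2 hu1
  have h2 : 0 < 1 + 2 * u := by positivity
  have h8 : 0 < 1 + 8 * u := by positivity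
  have hsub : 1 - f u = (1 - u) ^ 2 * (1 + 8 * u) / (1 + 2 * u) ^ 3 := by
    simp only [f]
    field_simp
    ring
  have hfu : 0 < f u := by positivity
  have hfs : 0 < 1 - f u := by rw [hsub]; positivity
  have hf'u : 0 < f' u := by positivity
  simp only [smul_eq_mul]
  refine Real.log_injOn_pos (Set.mem_Ioi.2 (by positivity)) (Set.mem_Ioi.2 (by positivity)) ?_
  have l54 : Real.log 54 = Real.log 2 + 3 * Real.log 3 := by
    rw [show (54:ℝ) = 2 * 3 ^ 3 by norm_num, Real.log_mul (by norm_num) (by norm_num),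
      Real.log_pow]
    norm_num
  have l27 : Real.log 27 = 3 * Real.log 3 := by
    rw [show (27:ℝ) = 3 ^ 3 by norm_num, Real.log_pow]
    norm_num
  have l6 : Real.log 6 = Real.log 2 + Real.log 3 := by
    rw [show (6:ℝ) = 2 * 3 by norm_num, Real.log_mul (by norm_num) (by norm_num)]
  have lf : Real.log (f u) = 3 * Real.log 3 + 2 * Real.log u - 3 * Real.log (1 + 2 * u) := by
    simp only [f]
    rw [Real.log_div (by positivity) (by positivity), Real.log_mul (by norm_num) (by positivity),
      Real.log_pow, Real.log_pow, l27]
    norm_num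
  have ls : Real.log (1 - f u) =
      2 * Real.log (1 - u) + Real.log (1 + 8 * u) - 3 * Real.log (1 + 2 * u) := by
    rw [hsub, Real.log_div (by positivity) (by positivity),
      Real.log_mul (by positivity) (by positivity), Real.log_pow, Real.log_pow]
    norm_num
  have lf' : Real.log (f' u) = Real.log 2 + 3 * Real.log 3 + Real.log u + Real.log (1 - u)
      - 4 * Real.log (1 + 2 * u) := by
    simp only [f']
    rw [Real.log_div (by positivity) (by positivity), Real.log_mul (by positivity) (by positivity),
      Real.log_mul (by norm_num) (by positivity), Real.log_pow, l54]
    norm_num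
  rw [Real.log_mul (by positivity) (by norm_num), Real.log_mul (by positivity) (by positivity),
    Real.log_rpow hu0, Real.log_rpow (by positivity), Real.log_mul h2.ne' h8.ne', l6,
    Real.log_mul hf'u.ne' (by positivity), Real.log_mul (by positivity) (by positivity),
    Real.log_rpow hfu, Real.log_rpow hfs, lf, ls, lf']
  ring

theorem appellF1_eq_integral :
    appellF1 (2/3) (1/2) (1/2) (5/3) (-2) (-8) =
      (((2/3) * ∫ u in (0:ℝ)..1,
        u ^ (-(1:ℝ)/3) * ((1 + 2*u) * (1 + 8*u)) ^ (-(1:ℝ)/2) : ℝ) : ℂ) := by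
  have hg : Complex.Gamma (5/3) = 2/3 * Complex.Gamma (2/3) := by
    rw [← Complex.Gamma_add_one _ (by norm_num)]
    norm_num
  have hg₀ : Complex.Gamma (2/3) ≠ 0 := Complex.Gamma_ne_zero_of_re_pos (by norm_num)
  rw [appellF1, lauricellaFD, hg, show (5/3 : ℂ) - 2/3 = 1 by norm_num, Complex.Gamma_one, mul_one,
    mul_div_cancel_right₀ _ hg₀, Complex.ofReal_mul, ← intervalIntegral.integral_ofReal]
  congr 1
  · norm_num
  refine intervalIntegral.integral_congr fun u hu ↦ ?_
  rw [Set.uIcc_of_le zero_le_one] at hu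
  have hu0 := hu.1
  have h2 : 0 ≤ 1 + 2 * u := by positivity
  have h8 : 0 ≤ 1 + 8 * u := by positivity
  simp only [Fin.prod_univ_two, Matrix.cons_val_zero, Matrix.cons_val_one, sub_self,
    Complex.cpow_zero, mul_one]
  rw [Real.mul_rpow h2 h8]
  push_cast [Complex.ofReal_cpow hu0, Complex.ofReal_cpow h2, Complex.ofReal_cpow h8]
  norm_num

theorem appell_value_goursat :
    appellF1 (2/3) (1/2) (1/2) (5/3) (-2) (-8) =
      ((Real.Gamma (1/3) ^ 3 / (3 * (16:ℝ) ^ ((1:ℝ)/3) * Real.sqrt 3 * Real.pi) : ℝ) : ℂ) ∧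
    (2/3) * ∫ u in (0:ℝ)..1, u ^ (-(1:ℝ)/3) * ((1 + 2*u) * (1 + 8*u)) ^ (-(1:ℝ)/2) =
      Real.Gamma (1/3) ^ 3 / (3 * (16:ℝ) ^ ((1:ℝ)/3) * Real.sqrt 3 * Real.pi) := by
  have h : (2/3) * ∫ u in (0:ℝ)..1, u ^ (-(1:ℝ)/3) * ((1 + 2*u) * (1 + 8*u)) ^ (-(1:ℝ)/2) =
      Real.Gamma (1/3) ^ 3 / (3 * (16:ℝ) ^ ((1:ℝ)/3) * Real.sqrt 3 * Real.pi) := by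
    have h16 : (16:ℝ) ^ ((1:ℝ)/3) = 2 * (2:ℝ) ^ ((1:ℝ)/3) := by
      rw [show (16:ℝ) = 2 ^ 3 * 2 by norm_num, Real.mul_rpow (by norm_num) (by norm_num),
        ← Real.rpow_natCast, ← Real.rpow_mul (by norm_num)]
      norm_num
    have h3 : √(3:ℝ) ^ 2 = 3 := Real.sq_sqrt (by norm_num)
    rw [integral_rpow_mul_appell_weight, beta_one_third_one_half, h16]
    field_simp
    rw [h3]
    norm_num
  exact ⟨by rw [appellF1_eq_integral, h], h⟩
end

section
/- Set x_1 = (3 − √33)/10, x_2 = 5(27 − 5√33)/(153 + 8√6 − 25√33), x_3 = 5(27 − 5√33)/(153 − 8√6 − 25√33), and define H_1 = F_D^{(3)}(1; −1/4, 1/2, 1/2; 3/2 | x_1, x_2, x_3) and H_2 = F_D^{(3)}(1; 3/4, 1/2, 1/2; 3/2 | x_1, x_2, x_3). Then (4/3)^{1/4} · K(1/√2) = √(12/125) · ( (15625(1649 + 225√33)/55296)^{1/4} · H_1 − (1/96)·√(5(1552√3 + 816√11)) · H_2 ). -/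
open MeasureTheory

/-- For parameters `a = 1`, `c = 3/2` and real arguments below `1`, the Euler integral is real. -/
lemma lauricellaFD_three_eq_ofReal (b : ℝ) (y₁ y₂ y₃ : ℝ) (h₁ : y₁ < 1) (h₂ : y₂ < 1)
    (h₃ : y₃ < 1) :
    lauricellaFD 3 1 ![-(b : ℂ), 1/2, 1/2] (3/2) ![(y₁ : ℂ), (y₂ : ℂ), (y₃ : ℂ)] =
      ((1/2 * ∫ u in (0:ℝ)..1, (1 - u) ^ (-(1/2) : ℝ) * ((1 - y₁ * u) ^ b *
        (1 - y₂ * u) ^ (-(1/2) : ℝ) * (1 - y₃ * u) ^ (-(1/2) : ℝ)) : ℝ) : ℂ) := by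
  have hpos : ∀ y : ℝ, y < 1 → ∀ u ∈ Set.Icc (0:ℝ) 1, 0 ≤ 1 - y * u := by
    intro y hy u hu
    nlinarith [hu.1, hu.2]
  have hG : Complex.Gamma (3/2) / (Complex.Gamma 1 * Complex.Gamma (3/2 - 1)) = 1/2 := by
    have h := Complex.Gamma_add_one (1/2) (by norm_num)
    have hne : Complex.Gamma (1/2) ≠ 0 := Complex.Gamma_ne_zero_of_re_pos (by norm_num)
    rw [show (3/2 : ℂ) = 1/2 + 1 by norm_num, h, Complex.Gamma_one]
    rw [show (1/2 + 1 - 1 : ℂ) = 1/2 by norm_num]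
    field_simp
  unfold lauricellaFD
  rw [hG, Complex.ofReal_mul, ← intervalIntegral.integral_ofReal]
  congr 1
  · norm_num
  · apply intervalIntegral.integral_congr
    intro u hu
    rw [Set.uIcc_of_le zero_le_one] at hu
    have hu' : 0 ≤ 1 - u := by linarith [hu.2]
    simp only [Fin.prod_univ_three, Matrix.cons_val]
    push_cast
    rw [Complex.ofReal_cpow hu', Complex.ofReal_cpow (hpos _ h₁ u hu),
      Complex.ofReal_cpow (hpos _ h₂ u hu), Complex.ofReal_cpow (hpos _ h₃ u hu)]
    push_cast
    norm_num

lemma intervalIntegrable_euler_kernel (b : ℝ) (y₁ y₂ y₃ : ℝ) (h₁ : y₁ < 1) (h₂ : y₂ < 1)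
    (h₃ : y₃ < 1) :
    IntervalIntegrable (fun u : ℝ ↦ (1 - u) ^ (-(1/2) : ℝ) * ((1 - y₁ * u) ^ b *
        (1 - y₂ * u) ^ (-(1/2) : ℝ) * (1 - y₃ * u) ^ (-(1/2) : ℝ))) volume 0 1 := by
  have hc : ∀ y : ℝ, y < 1 → ∀ p : ℝ, ContinuousOn (fun u : ℝ ↦ (1 - y * u) ^ p)
      (Set.uIcc 0 1) := by
    intro y hy p
    rw [Set.uIcc_of_le zero_le_one]
    apply ContinuousOn.rpow_const (by fun_prop)
    intro u hu
    left
    rcases eq_or_lt_of_le hu.2 with h | h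
    · rw [h]
      linarith
    · nlinarith [hu.1]
  apply IntervalIntegrable.mul_continuousOn _ (((hc _ h₁ _).mul (hc _ h₂ _)).mul (hc _ h₃ _))
  have h := (intervalIntegral.intervalIntegrable_rpow' (a := 0) (b := 1) (r := -(1/2))
    (by norm_num)).comp_sub_left 1
  simpa using h.symm

/-- The degree six covering map, as the square of the sine of the amplitude. -/
noncomputable def hermiteCover (x : ℝ) : ℝ :=
  (x ^ 2 + 6 * x - 15) * (x ^ 2 + 15 * x - 150) ^ 2 / (36 * x * (x ^ 2 - 75) ^ 2)

/-- The incomplete elliptic integral of the first kind of modulus `1 / √2`. -/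
noncomputable def lemniscaticF (θ : ℝ) : ℝ :=
  ∫ t in (0:ℝ)..θ, (1 - (1 / √2) ^ 2 * Real.sin t ^ 2) ^ (-(1:ℝ)/2)

lemma hasDerivAt_lemniscaticF (θ : ℝ) :
    HasDerivAt lemniscaticF ((1 - (1 / √2) ^ 2 * Real.sin θ ^ 2) ^ (-(1:ℝ)/2)) θ := by
  have hc : Continuous fun t : ℝ ↦ (1 - (1 / √2) ^ 2 * Real.sin t ^ 2) ^ (-(1:ℝ)/2) := by
    apply Continuous.rpow_const (by fun_prop)
    intro t
    left
    rw [div_pow, Real.sq_sqrt zero_le_two]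
    nlinarith [Real.sin_sq_le_one t]
  exact (hc.integral_hasStrictDerivAt 0 θ).hasDerivAt

lemma hasDerivAt_hermiteCover {x : ℝ} (hx : x ≠ 0) (h75 : x ^ 2 - 75 ≠ 0) :
    HasDerivAt hermiteCover ((x ^ 2 - 15) * (x ^ 2 + 75) * (x ^ 2 - 15 * x - 150) *
      (x ^ 2 + 15 * x - 150) / (36 * x ^ 2 * (x ^ 2 - 75) ^ 3)) x := by
  have hid := hasDerivAt_id' x
  have h := ((((hid.pow 2).add (hid.const_mul 6)).sub_const 15).mul
    ((((hid.pow 2).add (hid.const_mul 15)).sub_const 150).pow 2)).div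
    ((hid.const_mul 36).mul (((hid.pow 2).sub_const 75).pow 2))
    (by simp [hx, h75])
  refine h.congr_deriv ?_
  simp only [Pi.mul_apply, Pi.pow_apply, Pi.add_apply]
  field_simp
  ring

lemma hasDerivAt_lemniscaticF_arcsin_hermiteCover {x : ℝ} (hx : 0 < x)
    (hl : 0 < x ^ 2 + 15 * x - 150) (hr : x ^ 2 < 60) :
    HasDerivAt (fun x ↦ lemniscaticF (Real.arcsin √(hermiteCover x)))
      (3 * √2 * (x ^ 2 - 15) / √(x * (60 - x ^ 2) * (-x ^ 4 + 66 * x ^ 2 - 225))) x := by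
  have hx6 : 6 < x := by nlinarith
  have hx8 : x < 8 := by nlinarith
  have h75 : x ^ 2 - 75 < 0 := by linarith
  have h1 : 0 < x ^ 2 + 6 * x - 15 := by nlinarith
  have h2 : 0 < 15 + 6 * x - x ^ 2 := by nlinarith
  have h3 : 0 < 150 + 15 * x - x ^ 2 := by nlinarith
  have h4 : 0 < 60 - x ^ 2 := by linarith
  have h5 : 0 < x ^ 2 - 15 := by nlinarith
  have h6 : -x ^ 4 + 66 * x ^ 2 - 225 = (x ^ 2 + 6 * x - 15) * (15 + 6 * x - x ^ 2) := by ring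
  have h75' := h75.ne
  have hxne := hx.ne'
  have hsq : 0 < (x ^ 2 - 75) ^ 2 := by positivity
  have hQ : 0 < hermiteCover x := by
    unfold hermiteCover
    positivity
  have hQ1 : 1 - hermiteCover x =
      (60 - x ^ 2) * (x ^ 2 + 75) ^ 2 / (36 * x * (x ^ 2 - 75) ^ 2) := by
    unfold hermiteCover
    field_simp
    ring
  have hQ2 : 2 - hermiteCover x =
      (15 + 6 * x - x ^ 2) * (150 + 15 * x - x ^ 2) ^ 2 / (36 * x * (x ^ 2 - 75) ^ 2) := by
    unfold hermiteCover
    field_simp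
    ring
  have hQ1p : 0 < 1 - hermiteCover x := by rw [hQ1]; positivity
  have hQ2p : 0 < 1 - hermiteCover x / 2 := by linarith
  have hs1 : √(hermiteCover x) < 1 := by
    rw [Real.sqrt_lt' one_pos]
    linarith
  have hs0 := Real.sqrt_nonneg (hermiteCover x)
  have hD := (hasDerivAt_lemniscaticF (Real.arcsin √(hermiteCover x))).comp x
    ((Real.hasDerivAt_arcsin (by linarith) hs1.ne).comp x
      ((hasDerivAt_hermiteCover hxne h75').sqrt hQ.ne'))
  refine hD.congr_deriv ?_
  rw [Real.sin_arcsin (by linarith) hs1.le, Real.sq_sqrt hQ.le, div_pow, Real.sq_sqrt zero_le_two,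
    show (1 - 1 ^ 2 / 2 * hermiteCover x) = 1 - hermiteCover x / 2 by ring,
    show (-(1:ℝ) / 2) = -(1/2) by norm_num, Real.rpow_neg hQ2p.le, ← Real.sqrt_eq_rpow]
  set D := √(x * (60 - x ^ 2) * (-x ^ 4 + 66 * x ^ 2 - 225)) with hDdef
  have hWp : 0 < x * (60 - x ^ 2) * (-x ^ 4 + 66 * x ^ 2 - 225) := by rw [h6]; positivity
  have hDp : 0 < D := Real.sqrt_pos.2 hWp
  have hDsq : D ^ 2 = x * (60 - x ^ 2) * (-x ^ 4 + 66 * x ^ 2 - 225) := Real.sq_sqrt hWp.le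
  have hprod : √(1 - hermiteCover x / 2) * (√(1 - hermiteCover x) * √(hermiteCover x)) =
      D * ((x ^ 2 + 75) * (150 + 15 * x - x ^ 2) * (x ^ 2 + 15 * x - 150)) /
        (216 * √2 * x ^ 2 * (75 - x ^ 2) ^ 3) := by
    rw [← Real.sqrt_mul hQ1p.le, ← Real.sqrt_mul hQ2p.le]
    have h7 : 0 < 75 - x ^ 2 := by linarith
    rw [Real.sqrt_eq_iff_mul_self_eq (by positivity) (by positivity), ← pow_two, div_pow, mul_pow,
      hDsq, show 1 - hermiteCover x / 2 = (2 - hermiteCover x) / 2 by ring, hQ1, hQ2, hermiteCover,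
      h6, mul_pow, mul_pow, mul_pow (216 * √2 * x ^ 2), mul_pow (216 * √2), mul_pow 216, Real.sq_sqrt zero_le_two]
    have : x ^ 2 - 75 = -(75 - x ^ 2) := by ring
    rw [this]
    field_simp
    ring
  have e : ∀ a b c q : ℝ, a⁻¹ * (1 / b * (q / (2 * c))) = q / (2 * (a * (b * c))) := by
    intro a b c q
    field_simp
  rw [e, hprod]
  have h7 : 0 < 75 - x ^ 2 := by linarith
  have h8 : x ^ 2 - 75 = -(75 - x ^ 2) := by ring
  have h9 : x ^ 2 - 15 * x - 150 = -(150 + 15 * x - x ^ 2) := by ring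
  have h10 : x ^ 2 + 75 ≠ 0 := by positivity
  have hl' := hl.ne'
  have h3' := h3.ne'
  have h7' := h7.ne'
  rw [h8, h9]
  clear_value D
  generalize x ^ 2 + 15 * x - 150 = p at hl' ⊢
  generalize 150 + 15 * x - x ^ 2 = q at h3' ⊢
  generalize 75 - x ^ 2 = r at h7' ⊢
  generalize x ^ 2 + 75 = s at h10 ⊢
  field_simp
  ring

lemma euler_kernel_pullback {s q k x₁ w A B : ℝ} (hs0 : 0 < s) (hq0 : 0 < q) (hkp : 0 < k)
    (hx₁0 : x₁ < 0) (hw : 0 < w) (hA : 0 < A) (hB : 0 < B) (hc60 : 0 < 60 - s ^ 2) :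
    3 * √2 * (s ^ 2 * q ^ 4 - 15) /
        √(√(s ^ 2 * q ^ 4) * ((60 - s ^ 2) * w) * (k * (A * B))) *
        (s ^ 2 * (-x₁) / (2 * √(s ^ 2 * q ^ 4))) =
      √(9 * (s ^ 2) ^ (1 / 2 : ℝ) * x₁ ^ 2 / (2 * (60 - s ^ 2) * k)) *
        (s ^ 2 * (w ^ (-(1/2) : ℝ) * ((q ^ 4) ^ (1/4 : ℝ) * A ^ (-(1/2) : ℝ) *
            B ^ (-(1/2) : ℝ))) -
          15 * (w ^ (-(1/2) : ℝ) * ((q ^ 4) ^ (-(3/4) : ℝ) * A ^ (-(1/2) : ℝ) *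
            B ^ (-(1/2) : ℝ)))) := by
  have e1 : √(s ^ 2 * q ^ 4) = s * q ^ 2 := by
    rw [show s ^ 2 * q ^ 4 = (s * q ^ 2) ^ 2 by ring, Real.sqrt_sq (by positivity)]
  have e2 : (q ^ 4) ^ (1/4 : ℝ) = q := by
    rw [← Real.rpow_natCast, ← Real.rpow_mul hq0.le]
    norm_num
  have e3 : (q ^ 4) ^ (-(3/4) : ℝ) = (q ^ 3)⁻¹ := by
    rw [← Real.rpow_natCast, ← Real.rpow_mul hq0.le, ← Real.rpow_natCast, ← Real.rpow_neg hq0.le]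
    norm_num
  have e4 : ∀ z : ℝ, 0 < z → z ^ (-(1/2) : ℝ) = (√z)⁻¹ := by
    intro z hz
    rw [Real.rpow_neg hz.le, ← Real.sqrt_eq_rpow]
  have e5 : √(s * q ^ 2 * ((60 - s ^ 2) * w) * (k * (A * B))) =
      √((60 - s ^ 2) * s * k) * q * √w * √A * √B := by
    rw [Real.sqrt_eq_iff_mul_self_eq (by positivity) (by positivity), ← pow_two]
    simp only [mul_pow]
    rw [Real.sq_sqrt (by positivity), Real.sq_sqrt hw.le, Real.sq_sqrt hA.le, Real.sq_sqrt hB.le]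
    ring
  have e6 : √(9 * s * x₁ ^ 2 / (2 * (60 - s ^ 2) * k)) = 3 * √2 * s * (-x₁) / (2 * √((60 - s ^ 2) * s * k)) := by
    have : 0 < -x₁ := by linarith
    rw [Real.sqrt_eq_iff_mul_self_eq (by positivity) (by positivity), ← pow_two, div_pow]
    simp only [mul_pow]
    rw [Real.sq_sqrt zero_le_two, Real.sq_sqrt (by positivity)]
    field_simp
    ring
  rw [← Real.sqrt_eq_rpow, Real.sqrt_sq hs0.le, e1, e2, e3, e4 _ hw, e4 _ hA, e4 _ hB, e5, e6]
  have f1 : √w ≠ 0 := (Real.sqrt_pos.2 hw).ne'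
  have f2 : √A ≠ 0 := (Real.sqrt_pos.2 hA).ne'
  have f3 : √B ≠ 0 := (Real.sqrt_pos.2 hB).ne'
  have f4 : √((60 - s ^ 2) * s * k) ≠ 0 := (Real.sqrt_pos.2 (by positivity)).ne'
  generalize √w = U at *
  generalize √A = V at *
  generalize √B = W at *
  generalize √((60 - s ^ 2) * s * k) = Z at *
  field_simp

/-- The integral of the first kind pulled back along `hermiteCover` and `x ^ 2 = c * (1 - x₁ * u)`,
with `r = √33`. -/
lemma integral_euler_kernel (r x₁ x₂ x₃ c k : ℝ) (hr : 0 < r) (hr2 : r ^ 2 = 33)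
    (hx₁ : x₁ = (3 - r) / 10) (hc : c = 75 / 2 * (7 - r)) (hk : k = -c ^ 2 + 66 * c - 225)
    (hx₂ : x₂ < 1) (hx₃ : x₃ < 1)
    (hq : ∀ u : ℝ, -(c * (1 - x₁ * u)) ^ 2 + 66 * (c * (1 - x₁ * u)) - 225 =
      k * ((1 - x₂ * u) * (1 - x₃ * u))) :
    ellipticK (1 / √2) = √(9 * c ^ (1 / 2 : ℝ) * x₁ ^ 2 / (2 * (60 - c) * k)) *
      (c * (∫ u in (0:ℝ)..1, (1 - u) ^ (-(1/2) : ℝ) * ((1 - x₁ * u) ^ (1/4 : ℝ) *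
        (1 - x₂ * u) ^ (-(1/2) : ℝ) * (1 - x₃ * u) ^ (-(1/2) : ℝ))) -
      15 * (∫ u in (0:ℝ)..1, (1 - u) ^ (-(1/2) : ℝ) * ((1 - x₁ * u) ^ (-(3/4) : ℝ) *
        (1 - x₂ * u) ^ (-(1/2) : ℝ) * (1 - x₃ * u) ^ (-(1/2) : ℝ)))) := by
  have hr5 : 5.7 < r := by nlinarith
  have hr6 : r < 5.8 := by nlinarith
  have hx₁0 : x₁ < 0 := by rw [hx₁]; linarith
  have hx₁1 : x₁ < 1 := by linarith
  have hc0 : 0 < c := by rw [hc]; linarith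
  have hkp : 0 < k := by rw [hk, hc]; nlinarith
  have hcx : c * x₁ = c - 60 := by rw [hc, hx₁]; linear_combination (75 / 20) * hr2
  have hcsq : c = ((5 * r - 15) / 2) ^ 2 := by rw [hc]; linear_combination -(25 / 4) * hr2
  have hI₁ := intervalIntegrable_euler_kernel (1/4) x₁ x₂ x₃ hx₁1 hx₂ hx₃
  have hI₂ := intervalIntegrable_euler_kernel (-(3/4)) x₁ x₂ x₃ hx₁1 hx₂ hx₃
  rw [← intervalIntegral.integral_const_mul, ← intervalIntegral.integral_const_mul,
    ← intervalIntegral.integral_sub (hI₁.const_mul c) (hI₂.const_mul 15),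
    ← intervalIntegral.integral_const_mul]
  set G : ℝ → ℝ := fun u ↦
    lemniscaticF (Real.arcsin √(hermiteCover √(c * (1 - x₁ * u)))) with hG
  have hcu : ∀ u ∈ Set.Icc (0:ℝ) 1, c ≤ c * (1 - x₁ * u) ∧ c * (1 - x₁ * u) ≤ 60 := by
    intro u hu
    have h1 : c * (1 - x₁ * u) = c + (60 - c) * u := by linear_combination -u * hcx
    have h2 : 0 < 60 - c := by rw [hc]; linarith
    rw [h1]
    exact ⟨by nlinarith [hu.1], by nlinarith [hu.2]⟩
  have hlF : Continuous lemniscaticF :=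
    continuous_iff_continuousAt.2 fun θ ↦ (hasDerivAt_lemniscaticF θ).continuousAt
  have hcont : ContinuousOn G (Set.Icc 0 1) := by
    refine hlF.comp_continuousOn (Real.continuous_arcsin.comp_continuousOn
      (Real.continuous_sqrt.comp_continuousOn ?_))
    intro u hu
    obtain ⟨h1, h2⟩ := hcu u hu
    have hpos : 0 < c * (1 - x₁ * u) := hc0.trans_le h1
    have hD := hasDerivAt_hermiteCover (x := √(c * (1 - x₁ * u))) (Real.sqrt_pos.2 hpos).ne'
      (by rw [Real.sq_sqrt hpos.le]; linarith)
    exact (ContinuousAt.comp (f := fun u : ℝ ↦ √(c * (1 - x₁ * u))) hD.continuousAt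
      (by fun_prop)).continuousWithinAt
  have hG0 : G 0 = 0 := by
    have h : hermiteCover √(c * (1 - x₁ * 0)) = 0 := by
      rw [mul_zero, sub_zero, mul_one, hcsq, Real.sqrt_sq (by linarith), hermiteCover,
        show ((5 * r - 15) / 2) ^ 2 + 15 * ((5 * r - 15) / 2) - 150 = 0 by
          linear_combination (25 / 4) * hr2]
      simp
    simp only [hG]
    rw [h]
    simp [lemniscaticF]
  have hG1 : G 1 = ellipticK (1 / √2) := by
    have h : hermiteCover √(c * (1 - x₁ * 1)) = 1 := by
      rw [show c * (1 - x₁ * 1) = 60 by linarith]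
      have h60 : √60 ^ 2 = (60 : ℝ) := Real.sq_sqrt (by norm_num)
      have h60p : 0 < √(60 : ℝ) := by positivity
      rw [hermiteCover, div_eq_one_iff_eq (by rw [h60]; positivity), h60]
      linear_combination (1350 * √60 - 6075) * h60
    simp only [hG]
    rw [h]
    simp [lemniscaticF, ellipticK]
  rw [← hG1]
  symm
  refine Eq.trans ?_ ((congrArg (G 1 - ·) hG0).trans (sub_zero _))
  refine intervalIntegral.integral_eq_sub_of_hasDerivAt_of_le zero_le_one hcont ?_
    (((hI₁.const_mul c).sub (hI₂.const_mul 15)).const_mul _)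
  intro u hu
  obtain ⟨h1, h2⟩ := hcu u ⟨hu.1.le, hu.2.le⟩
  have h60 : 60 - c * (1 - x₁ * u) = (60 - c) * (1 - u) := by linear_combination u * hcx
  set y := 1 - x₁ * u with hy
  have hyp : 1 < y := by nlinarith [hu.1]
  have hy0 : 0 < y := by linarith
  have hpos : 0 < c * y := hc0.trans_le h1
  have hu1 : 0 < 1 - u := by linarith [hu.2]
  have hp : ∀ z : ℝ, z < 1 → 0 < 1 - z * u := by
    intro z hz
    nlinarith [hu.1, hu.2]
  have hxs : √(c * y) ^ 2 = c * y := Real.sq_sqrt hpos.le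
  have hlow : 0 < √(c * y) ^ 2 + 15 * √(c * y) - 150 := by
    have h3 : (5 * r - 15) / 2 < √(c * y) := by
      rw [Real.lt_sqrt (by linarith), ← hcsq]
      nlinarith
    nlinarith
  have hL : HasDerivAt (fun u : ℝ ↦ √(c * (1 - x₁ * u))) (c * (-x₁) / (2 * √(c * y))) u := by
    have h := ((((hasDerivAt_id' u).const_mul x₁).const_sub 1).const_mul c).sqrt
      (by rw [← hy]; exact hpos.ne')
    rwa [mul_one, ← hy] at h
  have hc60 : 0 < 60 - c := by rw [hc]; linarith
  have hD := (hasDerivAt_lemniscaticF_arcsin_hermiteCover (Real.sqrt_pos.2 hpos) hlow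
    (by rw [hxs]; linarith [mul_pos hc60 hu1])).comp_of_eq u hL (by rw [hy])
  refine HasDerivAt.congr_deriv (f := G) hD ?_
  rw [show -√(c * y) ^ 4 = -(√(c * y) ^ 2) ^ 2 by ring, hxs, h60, hq u]
  clear hD hL hG0 hG1 hcont hG hI₁ hI₂ hlF hcu hlow hxs hq
  have hA : 0 < 1 - x₂ * u := hp x₂ hx₂
  have hB : 0 < 1 - x₃ * u := hp x₃ hx₃
  clear_value y
  obtain ⟨q, hq0, rfl⟩ : ∃ q : ℝ, 0 < q ∧ q ^ 4 = y :=
    ⟨y ^ (1/4 : ℝ), by positivity, by rw [← Real.rpow_mul_natCast hy0.le]; norm_num⟩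
  obtain ⟨s, hs0, rfl⟩ : ∃ s : ℝ, 0 < s ∧ s ^ 2 = c := ⟨√c, by positivity, Real.sq_sqrt hc0.le⟩
  exact euler_kernel_pullback hs0 hq0 hkp hx₁0 hu1 hA hB hc60

theorem hermite_genus3_value :
    (((4/3 : ℝ) ^ ((1:ℝ)/4) * ellipticK (1 / Real.sqrt 2) : ℝ) : ℂ) =
      (Real.sqrt (12/125) : ℂ) *
        (((15625 * (1649 + 225 * Real.sqrt 33) / 55296 : ℝ) ^ ((1:ℝ)/4) : ℝ) *
            lauricellaFD 3 1 ![-1/4, 1/2, 1/2] (3/2)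
              ![((3 - Real.sqrt 33) / 10 : ℝ),
                ((5 * (27 - 5 * Real.sqrt 33)) / (153 + 8 * Real.sqrt 6 - 25 * Real.sqrt 33) : ℝ),
                ((5 * (27 - 5 * Real.sqrt 33)) / (153 - 8 * Real.sqrt 6 - 25 * Real.sqrt 33) : ℝ)] -
          ((1/96 : ℝ) * Real.sqrt (5 * (1552 * Real.sqrt 3 + 816 * Real.sqrt 11)) : ℝ) *
            lauricellaFD 3 1 ![3/4, 1/2, 1/2] (3/2)
              ![((3 - Real.sqrt 33) / 10 : ℝ),
                ((5 * (27 - 5 * Real.sqrt 33)) / (153 + 8 * Real.sqrt 6 - 25 * Real.sqrt 33) : ℝ),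
                ((5 * (27 - 5 * Real.sqrt 33)) / (153 - 8 * Real.sqrt 6 - 25 * Real.sqrt 33) : ℝ)]) := by
  obtain ⟨r, hr, hr0⟩ : ∃ r : ℝ, r = √33 ∧ 0 < r := ⟨√33, rfl, by positivity⟩
  have hr2 : r ^ 2 = 33 := by rw [hr]; exact Real.sq_sqrt (by norm_num)
  obtain ⟨s, hs, hs0⟩ : ∃ s : ℝ, s = √6 ∧ 0 < s := ⟨√6, rfl, by positivity⟩
  have hs2 : s ^ 2 = 6 := by rw [hs]; exact Real.sq_sqrt (by norm_num)
  rw [← hr, ← hs]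
  have hr5 : 5.744 < r := by nlinarith
  have hr6 : r < 5.745 := by nlinarith
  have hs5 : 2.449 < s := by nlinarith
  have hs6 : s < 2.45 := by nlinarith
  have hd₂ : 0 < 153 + 8 * s - 25 * r := by linarith
  have hd₃ : 153 - 8 * s - 25 * r < 0 := by linarith
  obtain ⟨x₁, hx₁⟩ : ∃ x₁, x₁ = (3 - r) / 10 := ⟨_, rfl⟩
  obtain ⟨x₂, hx₂⟩ : ∃ x₂, x₂ = 5 * (27 - 5 * r) / (153 + 8 * s - 25 * r) := ⟨_, rfl⟩
  obtain ⟨x₃, hx₃⟩ : ∃ x₃, x₃ = 5 * (27 - 5 * r) / (153 - 8 * s - 25 * r) := ⟨_, rfl⟩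
  rw [← hx₁, ← hx₂, ← hx₃]
  have hx₁1 : x₁ < 1 := by rw [hx₁]; linarith
  have hx₂1 : x₂ < 1 := by rw [hx₂, div_lt_one hd₂]; linarith
  have hx₃1 : x₃ < 1 := by rw [hx₃, div_lt_one_of_neg hd₃]; linarith
  obtain ⟨c, hc⟩ : ∃ c, c = 75 / 2 * (7 - r) := ⟨_, rfl⟩
  obtain ⟨k, hk⟩ : ∃ k, k = -c ^ 2 + 66 * c - 225 := ⟨_, rfl⟩
  have hc0 : 0 < c := by rw [hc]; linarith
  have hk0 : 0 < k := by rw [hk, hc]; nlinarith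
  have hkf : k = -((c - 33 + 12 * s) * (c - 33 - 12 * s)) := by
    rw [hk]
    linear_combination -144 * hs2
  have hx₂c : (c - 33 + 12 * s) * x₂ = c - 60 := by
    rw [hx₂, hc, mul_div_assoc', div_eq_iff hd₂.ne']
    ring
  have hx₃c : (c - 33 - 12 * s) * x₃ = c - 60 := by
    rw [hx₃, hc, mul_div_assoc', div_eq_iff hd₃.ne]
    ring
  have hsum : k * (x₂ + x₃) = (66 - 2 * c) * (c - 60) := by
    rw [hkf]
    linear_combination -(c - 33 - 12 * s) * hx₂c - (c - 33 + 12 * s) * hx₃c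
  have hprod : k * (x₂ * x₃) = -(c - 60) ^ 2 := by
    rw [hkf]
    linear_combination -(c - 33 - 12 * s) * x₃ * hx₂c - (c - 60) * hx₃c
  have hcx : c * x₁ = c - 60 := by rw [hc, hx₁]; linear_combination (75 / 20) * hr2
  have hK := integral_euler_kernel r x₁ x₂ x₃ c k hr0 hr2 hx₁ hc hk hx₂1 hx₃1 (by
    intro u
    linear_combination (2 * c * u - 66 * u - u ^ 2 * (c * x₁ + c - 60)) * hcx + u * hsum -
      u ^ 2 * hprod - hk)
  have h₁ := lauricellaFD_three_eq_ofReal (1/4) x₁ x₂ x₃ hx₁1 hx₂1 hx₃1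
  have h₂ := lauricellaFD_three_eq_ofReal (-(3/4)) x₁ x₂ x₃ hx₁1 hx₂1 hx₃1
  rw [show (-((1/4 : ℝ) : ℂ)) = -1/4 by push_cast; ring] at h₁
  rw [show (-((-(3/4) : ℝ) : ℂ)) = 3/4 by push_cast; ring] at h₂
  rw [h₁, h₂, hK]
  set I₁ := ∫ u in (0:ℝ)..1, (1 - u) ^ (-(1/2) : ℝ) * ((1 - x₁ * u) ^ (1/4 : ℝ) *
        (1 - x₂ * u) ^ (-(1/2) : ℝ) * (1 - x₃ * u) ^ (-(1/2) : ℝ))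
  set I₂ := ∫ u in (0:ℝ)..1, (1 - u) ^ (-(1/2) : ℝ) * ((1 - x₁ * u) ^ (-(3/4) : ℝ) *
        (1 - x₂ * u) ^ (-(1/2) : ℝ) * (1 - x₃ * u) ^ (-(1/2) : ℝ))
  have hkr : k = 2025 / 2 * (17 * r - 97) := by
    rw [hk, hc]
    linear_combination -(5625 / 4) * hr2
  have hc60 : 0 < 60 - c := by rw [hc]; linarith
  have hfour : ((4/3 : ℝ) ^ ((1:ℝ)/4)) ^ 4 = 4/3 := by
    rw [← Real.rpow_mul_natCast (by norm_num)]
    norm_num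
  have hκ : √(9 * c ^ (1 / 2 : ℝ) * x₁ ^ 2 / (2 * (60 - c) * k)) ^ 4 =
      81 * c * x₁ ^ 4 / (4 * ((60 - c) ^ 2 * k ^ 2)) := by
    rw [show ∀ z : ℝ, z ^ 4 = (z ^ 2) ^ 2 by intro z; ring, Real.sq_sqrt (by positivity),
      ← Real.sqrt_eq_rpow, div_pow, mul_pow, mul_pow, Real.sq_sqrt hc0.le]
    ring
  have h125 : √(12/125 : ℝ) ^ 4 = (12/125) ^ 2 := by
    rw [show ∀ z : ℝ, z ^ 4 = (z ^ 2) ^ 2 by intro z; ring, Real.sq_sqrt (by norm_num)]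
  have hden : 4 * ((60 - c) ^ 2 * k ^ 2) ≠ 0 := by positivity
  have hA : (4/3 : ℝ) ^ ((1:ℝ)/4) * √(9 * c ^ (1 / 2 : ℝ) * x₁ ^ 2 / (2 * (60 - c) * k)) * c =
      √(12/125) * (15625 * (1649 + 225 * r) / 55296 : ℝ) ^ ((1:ℝ)/4) / 2 := by
    have h4 : ((15625 * (1649 + 225 * r) / 55296 : ℝ) ^ ((1:ℝ)/4)) ^ 4 =
        15625 * (1649 + 225 * r) / 55296 := by
      rw [← Real.rpow_mul_natCast (by positivity)]
      norm_num
    rw [← pow_left_inj₀ (by positivity) (by positivity) (four_ne_zero)]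
    simp only [mul_pow (_ : ℝ) _ 4, div_pow (_ : ℝ) _ 4]
    rw [hfour, hκ, h125, h4, mul_div_assoc', div_mul_eq_mul_div, div_eq_iff hden, hkr, hc, hx₁]
    linear_combination 4 * ((105141087369421875/32768) - (61052574088828125/32768) * r +
      (12861407434078125/32768) * r ^ 2 - (1263570995671875/32768) * r ^ 3 + (1318248421875/512)
      * r ^ 4 - (102208078125/512) * r ^ 5 + (4818234375/512) * r ^ 6 - (102515625/512) * r ^ 7)
      * hr2
  have hB : (4/3 : ℝ) ^ ((1:ℝ)/4) * √(9 * c ^ (1 / 2 : ℝ) * x₁ ^ 2 / (2 * (60 - c) * k)) * 15 =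
      √(12/125) * ((1/96 : ℝ) * √(5 * (1552 * √3 + 816 * √11))) / 2 := by
    have h33 : √3 * √11 = r := by
      rw [hr, ← Real.sqrt_mul (by norm_num)]
      norm_num
    have h3 : √3 ^ 2 = (3 : ℝ) := Real.sq_sqrt (by norm_num)
    have h11 : √11 ^ 2 = (11 : ℝ) := Real.sq_sqrt (by norm_num)
    have h4 : √(5 * (1552 * √3 + 816 * √11)) ^ 4 =
        25 * (1552 ^ 2 * 3 + 816 ^ 2 * 11 + 2 * 1552 * 816 * r) := by
      rw [show ∀ z : ℝ, z ^ 4 = (z ^ 2) ^ 2 by intro z; ring, Real.sq_sqrt (by positivity)]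
      linear_combination 25 * 1552 ^ 2 * h3 + 25 * 816 ^ 2 * h11 + 25 * 2 * 1552 * 816 * h33
    rw [← pow_left_inj₀ (by positivity) (by positivity) (four_ne_zero)]
    simp only [mul_pow (_ : ℝ) _ 4, div_pow (_ : ℝ) _ 4]
    rw [hfour, hκ, h125, h4, mul_div_assoc', div_mul_eq_mul_div, div_eq_iff hden, hkr, hc, hx₁]
    linear_combination 4 * ((968890286286675/32768) - (529798299630525/32768) * r +
      (96542940192525/32768) * r ^ 2 - (5862761813475/32768) * r ^ 3) * hr2
  norm_cast
  linear_combination I₁ * hA - I₂ * hB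
end

section
/- Set w_1 = (5/567)(23 − 16√22), w_2 = 1/2 − 17/(8√22), w_3 = 16√22 − 75, and define L_1 = F_D^{(3)}(1/2; 1/4, 1/2, 1/2; 1 | w_1, w_2, w_3) and L_2 = F_D^{(3)}(1/2; −3/4, 1/2, 1/2; 1 | w_1, w_2, w_3). Then (4/3)^{1/4} · K(1/√2) = (91π / (6·(264(169 + 36√22))^{1/4})) · L_1 − ((113 − 20√22)^{3/4} · π / (2·3^{1/4}·√(176 + 38√22))) · L_2. -/
open MeasureTheory

theorem genus4_norm_identity (s u : ℝ) (hs : s ^ 2 = 22) :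
    (1 - (5/567) * (23 - 16 * s) * u) ^ 3 * (1 - (16 * s - 75) * u) ^ 2 *
        (1 - (-9/14 + s/7) * u) ^ 4 -
      (1 - u) ^ 2 * (1 + (-1519/108 + 323/108 * s) * u + (1993/756 - 425/756 * s) * u ^ 2) ^ 4 =
    (1892/9 - 397/9 * s) * u * (1 - (1/2 - 17/176 * s) * u) *
      (1 + (75967/6804 - 32731/13608 * s) * u + (-311233/15876 + 132781/31752 * s) * u ^ 2 +
        (9130201/777924 - 3893245/1555848 * s) * u ^ 3 +
        (232469/333396 - 99125/666792 * s) * u ^ 4) ^ 2 := by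
  linear_combination
    ((-92231/99792) * u ^ 2 +
      (-148236762043/339492384 + 972775882/10609137 * s) * u ^ 3 +
      (-3496966712329877/2395458261504 + 13783579688621/21388020192 * s -
        48539429803339/684416646144 * s ^ 2) * u ^ 4 +
      (18130817516187377/8384103915264 - 455914492665083/524006494704 * s +
        16711932870821/217768932864 * s ^ 2 + 35089520/15752961 * s ^ 3) * u ^ 5 +
      (-731497671053803585/352132364441088 + 6168231166651469/7336090925856 * s -
        7031271013816703/100609246983168 * s ^ 2 - 1535019968/330812181 * s ^ 3 +
        2767119872/8931928887 * s ^ 4) * u ^ 6 +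
      (1419392101763142373/1437873821467776 - 16973889418655233/29955704613912 * s +
        7428068589458945/58688727406848 * s ^ 2 - 2313479615200/145888171821 * s ^ 3 +
        26883837440/20841167403 * s ^ 4 - 6545121280/145888171821 * s ^ 5) * u ^ 7 +
      (574861415132119397/5751495285871104 - 90075166251629/1556140499424 * s +
        131877124314528925/11502990571742208 * s ^ 2 - 70848548800/145888171821 * s ^ 3 -
        9166835200/48629390607 * s ^ 4 + 5305548800/145888171821 * s ^ 5 -
        99942400/48629390607 * s ^ 6) * u ^ 8 +
      (-153357995816747789/1232463275543808 + 2679212968887205/25676318240496 * s -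
        92097561123002125/2464926551087616 * s ^ 2 + 3511419626000/437664515463 * s ^ 3 -
        539404480000/437664515463 * s ^ 4 + 60093440000/437664515463 * s ^ 5 -
        1384448000/145888171821 * s ^ 6 + 131072000/437664515463 * s ^ 7) * u ^ 9 +
      (-4988415493783/39125818271232 + 18863290375/349337663136 * s -
        447361109375/78251636542464 * s ^ 2) * u ^ 10) * hs

theorem genus4_logDeriv_identity (s u : ℝ) (hs : s ^ 2 = 22) :
    (1/2) * (1 + (-1519/108 + 323/108 * s) * u + (1993/756 - 425/756 * s) * u ^ 2) *
        (1 - (5/567) * (23 - 16 * s) * u) * (1 - (16 * s - 75) * u) * (1 - (-9/14 + s/7) * u) -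
      ((-1519/108 + 323/108 * s) + 2 * (1993/756 - 425/756 * s) * u) * (1 - u) *
        (1 - (5/567) * (23 - 16 * s) * u) * (1 - (16 * s - 75) * u) * (1 - (-9/14 + s/7) * u) -
      (3/4) * ((5/567) * (23 - 16 * s)) * (1 - u) *
        (1 + (-1519/108 + 323/108 * s) * u + (1993/756 - 425/756 * s) * u ^ 2) *
        (1 - (16 * s - 75) * u) * (1 - (-9/14 + s/7) * u) -
      (1/2) * (16 * s - 75) * (1 - u) *
        (1 + (-1519/108 + 323/108 * s) * u + (1993/756 - 425/756 * s) * u ^ 2) *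
        (1 - (5/567) * (23 - 16 * s) * u) * (1 - (-9/14 + s/7) * u) -
      (-9/14 + s/7) * (1 - u) *
        (1 + (-1519/108 + 323/108 * s) * u + (1993/756 - 425/756 * s) * u ^ 2) *
        (1 - (5/567) * (23 - 16 * s) * u) * (1 - (16 * s - 75) * u) =
    (473/9 - 397/36 * s) *
      (1 + (75967/6804 - 32731/13608 * s) * u + (-311233/15876 + 132781/31752 * s) * u ^ 2 +
        (9130201/777924 - 3893245/1555848 * s) * u ^ 3 +
        (232469/333396 - 99125/666792 * s) * u ^ 4) * (1 - (5/6 - 5/33 * s) * u) := by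
  linear_combination
    ((-92231/199584) * u +
      (252508859/32332608 - 182014493/113164128 * s) * u ^ 2 +
      (48711754733/1232231616 - 337068335/24004512 * s + 129200/107163 * s ^ 2) * u ^ 3 +
      (-74689348883/3696694848 + 14621953315/1848347424 * s - 576640/750141 * s ^ 2) * u ^ 4 +
      (-1735036865/1584297792 + 353085515/792148896 * s - 34000/750141 * s ^ 2) * u ^ 5) * hs

open Set in
theorem ellipticK_inv_sqrt_two_pullback {y y' : ℝ → ℝ} (hc : ContinuousOn y (Icc 0 1))
    (hy0 : y 0 = 1) (hy1 : y 1 = 0) (hd : ∀ u ∈ Ioo (0 : ℝ) 1, HasDerivAt y (y' u) u)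
    (hpos : ∀ u ∈ Ioo (0 : ℝ) 1, 0 < y u) (hlt : ∀ u ∈ Ioo (0 : ℝ) 1, y u < 1)
    (hneg : ∀ u ∈ Ioo (0 : ℝ) 1, y' u ≤ 0) :
    IntervalIntegrable (fun u => -y' u / √(1 - y u ^ 4)) volume 0 1 ∧
      ∫ u in (0 : ℝ)..1, -y' u / √(1 - y u ^ 4) = ellipticK (1 / √2) / √2 := by
  set g : ℝ → ℝ := fun θ => (1 - (1 / √2) ^ 2 * Real.sin θ ^ 2) ^ (-(1 : ℝ) / 2) with hg
  have hk : (1 / √2 : ℝ) ^ 2 = 1 / 2 := by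
    rw [div_pow, Real.sq_sqrt (by norm_num)]; norm_num
  have hbase : ∀ θ : ℝ, 0 < 1 - (1 / √2) ^ 2 * Real.sin θ ^ 2 := fun θ => by
    rw [hk]; nlinarith [Real.sin_sq_le_one θ]
  have hgc : Continuous g :=
    Continuous.rpow_const (by fun_prop) fun θ => Or.inl (hbase θ).ne'
  set G : ℝ → ℝ := fun φ => ∫ θ in (0 : ℝ)..φ, g θ with hG
  have hGd : ∀ φ, HasDerivAt G (g φ) φ := fun φ =>
    intervalIntegral.integral_hasDerivAt_right (hgc.intervalIntegrable _ _)
      (hgc.stronglyMeasurableAtFilter _ _) hgc.continuousAt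
  have hGc : Continuous G := continuous_iff_continuousAt.2 fun φ => (hGd φ).continuousAt
  have hΦc : ContinuousOn (fun u => G (Real.arccos (y u)) / √2) (Icc 0 1) :=
    ((hGc.comp Real.continuous_arccos).comp_continuousOn hc).div_const _
  have hΦd : ∀ u ∈ Ioo (0 : ℝ) 1, HasDerivAt (fun u => G (Real.arccos (y u)) / √2)
      (-y' u / √(1 - y u ^ 4)) u := by
    intro u hu
    have h0 := hpos u hu
    have h1 := hlt u hu
    have h := ((hGd (Real.arccos (y u))).comp u
      ((Real.hasDerivAt_arccos (by linarith) h1.ne).comp u (hd u hu))).div_const √2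
    refine h.congr_deriv ?_
    have hq : 0 < 1 - y u ^ 2 := by nlinarith
    have hp : 0 < 1 + y u ^ 2 := by positivity
    have e1 : g (Real.arccos (y u)) = √2 / √(1 + y u ^ 2) := by
      have hsin : 1 - (1 / √2) ^ 2 * Real.sin (Real.arccos (y u)) ^ 2 = (1 + y u ^ 2) / 2 := by
        rw [hk, Real.sin_arccos, Real.sq_sqrt hq.le]; ring
      simp only [hg]
      rw [hsin, neg_div, Real.rpow_neg (by positivity), ← Real.sqrt_eq_rpow,
        Real.sqrt_div hp.le, inv_div]
    have e2 : √(1 - y u ^ 4) = √(1 - y u ^ 2) * √(1 + y u ^ 2) := by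
      rw [← Real.sqrt_mul hq.le]; congr 1; ring
    have := Real.sqrt_pos.2 hq
    have := Real.sqrt_pos.2 hp
    rw [e1, e2]
    field_simp
  have hint : IntervalIntegrable (fun u => -y' u / √(1 - y u ^ 4)) volume 0 1 := by
    rw [intervalIntegrable_iff_integrableOn_Ioc_of_le zero_le_one]
    exact intervalIntegral.integrableOn_deriv_of_nonneg hΦc hΦd fun u hu =>
      div_nonneg (neg_nonneg.2 (hneg u hu)) (Real.sqrt_nonneg _)
  refine ⟨hint, ?_⟩
  rw [intervalIntegral.integral_eq_sub_of_hasDerivAt_of_le zero_le_one hΦc hΦd hint]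
  simp [hy0, hy1, hG, hg, ellipticK]

theorem hasDerivAt_one_sub_mul (w u : ℝ) : HasDerivAt (fun u => 1 - w * u) (-w) u := by
  simpa using ((hasDerivAt_id u).const_mul w).const_sub 1

theorem HasDerivAt.sqrt_eq_mul {f : ℝ → ℝ} {f' u : ℝ} (hf : HasDerivAt f f' u) (h : 0 < f u) :
    HasDerivAt (fun u => √(f u)) (√(f u) * (f' / (2 * f u))) u := by
  refine (hf.sqrt h.ne').congr_deriv ?_
  have h1 := Real.sq_sqrt h.le
  have h2 := Real.sqrt_pos.2 h
  generalize √(f u) = c at *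
  rw [← h1]
  field_simp

open Set in
theorem ellipticK_inv_sqrt_two_eq_integral {w₁ w₂ w₃ α b₁ b₂ r κ₁ κ₂ : ℝ} {q : ℝ → ℝ}
    (h₁ : ∀ u ∈ Icc (0 : ℝ) 1, 0 < 1 - w₁ * u) (h₂ : ∀ u ∈ Icc (0 : ℝ) 1, 0 < 1 - w₂ * u)
    (h₃ : ∀ u ∈ Icc (0 : ℝ) 1, 0 < 1 - w₃ * u) (hα : ∀ u ∈ Icc (0 : ℝ) 1, 0 < 1 - α * u)
    (hr : ∀ u ∈ Icc (0 : ℝ) 1, 0 < 1 - r * u)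
    (hL : ∀ u ∈ Icc (0 : ℝ) 1, 0 < 1 + b₁ * u + b₂ * u ^ 2)
    (hq : ∀ u ∈ Icc (0 : ℝ) 1, 0 < q u) (hκ₁ : 0 < κ₁) (hκ₂ : 0 < κ₂)
    (hnorm : ∀ u, (1 - w₁ * u) ^ 3 * (1 - w₃ * u) ^ 2 * (1 - α * u) ^ 4 -
      (1 - u) ^ 2 * (1 + b₁ * u + b₂ * u ^ 2) ^ 4 = κ₂ * u * (1 - w₂ * u) * q u ^ 2)
    (hlog : ∀ u, (1 / 2) * (1 + b₁ * u + b₂ * u ^ 2) * (1 - w₁ * u) * (1 - w₃ * u) * (1 - α * u) -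
      (b₁ + 2 * b₂ * u) * (1 - u) * (1 - w₁ * u) * (1 - w₃ * u) * (1 - α * u) -
      (3 / 4) * w₁ * (1 - u) * (1 + b₁ * u + b₂ * u ^ 2) * (1 - w₃ * u) * (1 - α * u) -
      (1 / 2) * w₃ * (1 - u) * (1 + b₁ * u + b₂ * u ^ 2) * (1 - w₁ * u) * (1 - α * u) -
      α * (1 - u) * (1 + b₁ * u + b₂ * u ^ 2) * (1 - w₁ * u) * (1 - w₃ * u) =
      κ₁ * q u * (1 - r * u)) :
    IntervalIntegrable (fun u => κ₁ / √κ₂ * (1 - r * u) / (√u * √(1 - u) *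
        (1 - w₁ * u) ^ (1 / 4 : ℝ) * √(1 - w₂ * u) * √(1 - w₃ * u))) volume 0 1 ∧
      ∫ u in (0 : ℝ)..1, κ₁ / √κ₂ * (1 - r * u) / (√u * √(1 - u) *
        (1 - w₁ * u) ^ (1 / 4 : ℝ) * √(1 - w₂ * u) * √(1 - w₃ * u)) =
        ellipticK (1 / √2) / √2 := by
  set y : ℝ → ℝ := fun u => √(1 - u) * (1 + b₁ * u + b₂ * u ^ 2) /
    (((1 - w₁ * u) ^ (1 / 4 : ℝ)) ^ 3 * √(1 - w₃ * u) * (1 - α * u)) with hy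
  set y' : ℝ → ℝ := fun u => -(y u * (κ₁ * q u * (1 - r * u) /
    ((1 - u) * (1 + b₁ * u + b₂ * u ^ 2) * (1 - w₁ * u) * (1 - w₃ * u) * (1 - α * u)))) with hy'
  have hroot : ∀ u ∈ Icc (0 : ℝ) 1, 0 < (1 - w₁ * u) ^ (1 / 4 : ℝ) := fun u hu =>
    Real.rpow_pos_of_pos (h₁ u hu) _
  have hroot4 : ∀ u ∈ Icc (0 : ℝ) 1, ((1 - w₁ * u) ^ (1 / 4 : ℝ)) ^ 4 = 1 - w₁ * u :=
    fun u hu => by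
      rw [← Real.rpow_natCast, ← Real.rpow_mul (h₁ u hu).le]; norm_num
  have hden : ∀ u ∈ Icc (0 : ℝ) 1,
      0 < ((1 - w₁ * u) ^ (1 / 4 : ℝ)) ^ 3 * √(1 - w₃ * u) * (1 - α * u) := fun u hu =>
    mul_pos (mul_pos (pow_pos (hroot u hu) 3) (Real.sqrt_pos.2 (h₃ u hu))) (hα u hu)
  have hc : ContinuousOn y (Icc 0 1) := by
    refine ContinuousOn.div (by fun_prop) ?_ fun u hu => (hden u hu).ne'
    refine ContinuousOn.mul (ContinuousOn.mul (ContinuousOn.pow ?_ 3) (by fun_prop))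
      (by fun_prop)
    exact ContinuousOn.rpow_const (by fun_prop) fun u hu => Or.inl (h₁ u hu).ne'
  have hpos : ∀ u ∈ Ioo (0 : ℝ) 1, 0 < y u := fun u hu =>
    div_pos (mul_pos (Real.sqrt_pos.2 (by linarith [hu.2])) (hL u (Ioo_subset_Icc_self hu)))
      (hden u (Ioo_subset_Icc_self hu))
  have hone : ∀ u ∈ Ioo (0 : ℝ) 1, 1 - y u ^ 4 = (√κ₂ * √u * √(1 - w₂ * u) * q u /
      (((1 - w₁ * u) ^ (1 / 4 : ℝ)) ^ 6 * (1 - w₃ * u) * (1 - α * u) ^ 2)) ^ 2 := by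
    intro u hu
    have hu' := Ioo_subset_Icc_self hu
    have e1 := hroot4 u hu'
    have e2 := Real.sq_sqrt (h₂ u hu').le
    have e3 := Real.sq_sqrt (h₃ u hu').le
    have e4 := Real.sq_sqrt hκ₂.le
    have e5 := Real.sq_sqrt hu.1.le
    have e6 := Real.sq_sqrt (show 0 ≤ 1 - u by linarith [hu.2])
    have p1 := h₁ u hu'
    have p3 := h₃ u hu'
    have pα := hα u hu'
    have hn := hnorm u
    have a1 : y u ^ 4 = (1 - u) ^ 2 * (1 + b₁ * u + b₂ * u ^ 2) ^ 4 /
        ((1 - w₁ * u) ^ 3 * (1 - w₃ * u) ^ 2 * (1 - α * u) ^ 4) := by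
      simp only [hy]
      rw [div_pow]
      congr 1
      · rw [mul_pow, show √(1 - u) ^ 4 = (√(1 - u) ^ 2) ^ 2 by ring, e6]
      · rw [mul_pow, mul_pow, show √(1 - w₃ * u) ^ 4 = (√(1 - w₃ * u) ^ 2) ^ 2 by ring, e3,
          ← pow_mul, mul_comm 3 4, pow_mul, e1]
    have hD : 0 < (1 - w₁ * u) ^ 3 * (1 - w₃ * u) ^ 2 * (1 - α * u) ^ 4 := by positivity
    rw [a1, one_sub_div hD.ne', hn, div_pow, mul_pow, mul_pow, mul_pow, e2, e4, e5,
      mul_pow, mul_pow, ← pow_mul,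
      show 6 * 2 = 4 * 3 from rfl, pow_mul, e1, ← pow_mul]
  have hsqrt : ∀ u ∈ Ioo (0 : ℝ) 1, 0 < √κ₂ * √u * √(1 - w₂ * u) * q u /
      (((1 - w₁ * u) ^ (1 / 4 : ℝ)) ^ 6 * (1 - w₃ * u) * (1 - α * u) ^ 2) := by
    intro u hu
    have hu' := Ioo_subset_Icc_self hu
    have := hroot u hu'
    have := h₃ u hu'
    have := hα u hu'
    have := hq u hu'
    have := Real.sqrt_pos.2 (h₂ u hu')
    have := Real.sqrt_pos.2 hu.1
    have := Real.sqrt_pos.2 hκ₂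
    positivity
  have hlt : ∀ u ∈ Ioo (0 : ℝ) 1, y u < 1 := by
    intro u hu
    have h := pow_pos (hsqrt u hu) 2
    rw [← hone u hu, sub_pos] at h
    by_contra! hge
    linarith [one_le_pow₀ hge (n := 4)]
  have hneg : ∀ u ∈ Ioo (0 : ℝ) 1, y' u ≤ 0 := by
    intro u hu
    have hu' := Ioo_subset_Icc_self hu
    have := hpos u hu
    have := h₁ u hu'
    have := h₃ u hu'
    have := hα u hu'
    have := hq u hu'
    have := hr u hu'
    have := hL u hu'
    have : 0 < 1 - u := by linarith [hu.2]
    simp only [hy', neg_nonpos]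
    positivity
  have hd : ∀ u ∈ Ioo (0 : ℝ) 1, HasDerivAt y (y' u) u := by
    intro u hu
    have hu' := Ioo_subset_Icc_self hu
    have p0 : 0 < 1 - u := by linarith [hu.2]
    have p1 := h₁ u hu'
    have p3 := h₃ u hu'
    have pα := hα u hu'
    have pL := hL u hu'
    have pc := hroot u hu'
    have p0' := Real.sqrt_pos.2 p0
    have p3' := Real.sqrt_pos.2 p3
    have d0 : HasDerivAt (fun u => √(1 - u)) (√(1 - u) * (-1 / (2 * (1 - u)))) u :=
      ((hasDerivAt_id u).const_sub 1).sqrt_eq_mul p0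
    have d3 := (hasDerivAt_one_sub_mul w₃ u).sqrt_eq_mul p3
    have d1 : HasDerivAt (fun u => (1 - w₁ * u) ^ (1 / 4 : ℝ))
        ((1 - w₁ * u) ^ (1 / 4 : ℝ) * (-w₁ / (4 * (1 - w₁ * u)))) u := by
      refine ((hasDerivAt_one_sub_mul w₁ u).rpow_const (p := 1 / 4) (Or.inl p1.ne')).congr_deriv ?_
      rw [Real.rpow_sub_one p1.ne']
      generalize 1 - w₁ * u = A at *
      field_simp
    have dL : HasDerivAt (fun u => 1 + b₁ * u + b₂ * u ^ 2) (b₁ + 2 * b₂ * u) u := by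
      refine ((((hasDerivAt_id u).const_mul b₁).const_add 1).add
        (((hasDerivAt_id u).pow 2).const_mul b₂)).congr_deriv ?_
      simp; ring
    refine ((d0.mul dL).div (((d1.pow 3).mul d3).mul (hasDerivAt_one_sub_mul α u))
      (hden u hu').ne').congr_deriv ?_
    have hl := hlog u
    simp only [hy', hy, Pi.mul_apply, Pi.pow_apply]
    rw [← hl]
    clear hl d0 d1 d3 dL
    generalize (1 - w₁ * u) ^ (1 / 4 : ℝ) = c at *
    generalize √(1 - u) = s0 at *
    generalize √(1 - w₃ * u) = s3 at *
    generalize 1 - w₁ * u = A at *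
    generalize 1 - w₃ * u = B at *
    generalize 1 - α * u = C at *
    generalize 1 - u = D at *
    generalize 1 + b₁ * u + b₂ * u ^ 2 = E at *
    field_simp
    ring
  have hy0 : y 0 = 1 := by simp [hy]
  have hy1 : y 1 = 0 := by simp [hy]
  have heq : ∀ u ∈ Ioo (0 : ℝ) 1, -y' u / √(1 - y u ^ 4) = κ₁ / √κ₂ * (1 - r * u) /
      (√u * √(1 - u) * (1 - w₁ * u) ^ (1 / 4 : ℝ) * √(1 - w₂ * u) * √(1 - w₃ * u)) := by
    intro u hu
    have hu' := Ioo_subset_Icc_self hu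
    rw [hone u hu, Real.sqrt_sq (hsqrt u hu).le]
    have p0 : 0 < 1 - u := by linarith [hu.2]
    have pα := hα u hu'
    have pL := hL u hu'
    have pq := hq u hu'
    have pc := hroot u hu'
    have p0' := Real.sqrt_pos.2 p0
    have p2' := Real.sqrt_pos.2 (h₂ u hu')
    have p3' := Real.sqrt_pos.2 (h₃ u hu')
    have pu' := Real.sqrt_pos.2 hu.1
    have pκ := Real.sqrt_pos.2 hκ₂
    have p1 := h₁ u hu'
    have p3 := h₃ u hu'
    have e1 := hroot4 u hu'
    have e3 := Real.sq_sqrt p3.le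
    have e6 := Real.sq_sqrt p0.le
    simp only [hy', hy]
    generalize (1 - w₁ * u) ^ (1 / 4 : ℝ) = c at *
    generalize √(1 - u) = s0 at *
    generalize √(1 - w₃ * u) = s3 at *
    generalize 1 - w₁ * u = A at *
    generalize 1 - w₃ * u = B at *
    generalize 1 - α * u = C at *
    generalize 1 - u = D at *
    generalize 1 + b₁ * u + b₂ * u ^ 2 = E at *
    rw [← e1, ← e6]
    field_simp
  obtain ⟨hi, hv⟩ := ellipticK_inv_sqrt_two_pullback hc hy0 hy1 hd hpos hlt hneg
  have hae : ∀ᵐ u ∂(volume : Measure ℝ), u ∈ uIoc (0 : ℝ) 1 →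
      -y' u / √(1 - y u ^ 4) = κ₁ / √κ₂ * (1 - r * u) /
      (√u * √(1 - u) * (1 - w₁ * u) ^ (1 / 4 : ℝ) * √(1 - w₂ * u) * √(1 - w₃ * u)) := by
    filter_upwards [compl_mem_ae_iff.2 (measure_singleton (μ := volume) (1 : ℝ))] with u hu1 hu
    rw [uIoc_of_le zero_le_one] at hu
    exact heq u ⟨hu.1, lt_of_le_of_ne hu.2 hu1⟩
  exact ⟨hi.congr_ae ((ae_restrict_iff' measurableSet_uIoc).2 hae),
    (intervalIntegral.integral_congr_ae hae).symm.trans hv⟩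

open Set in
theorem lauricellaFD_three_half_eq_integral {w₁ w₂ w₃ : ℝ} (β : ℝ)
    (h₁ : ∀ u ∈ Icc (0 : ℝ) 1, 0 < 1 - w₁ * u) (h₂ : ∀ u ∈ Icc (0 : ℝ) 1, 0 < 1 - w₂ * u)
    (h₃ : ∀ u ∈ Icc (0 : ℝ) 1, 0 < 1 - w₃ * u) :
    lauricellaFD 3 (1 / 2) ![(β : ℂ), 1 / 2, 1 / 2] 1 ![(w₁ : ℂ), w₂, w₃] =
      ((1 / Real.pi * ∫ u in (0 : ℝ)..1, (1 - w₁ * u) ^ (-β) /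
        (√u * √(1 - u) * √(1 - w₂ * u) * √(1 - w₃ * u)) : ℝ) : ℂ) := by
  have hΓ : Complex.Gamma 1 / (Complex.Gamma (1 / 2) * Complex.Gamma (1 - 1 / 2)) =
      ((1 / Real.pi : ℝ) : ℂ) := by
    rw [show (1 - 1 / 2 : ℂ) = 1 / 2 by norm_num, Complex.Gamma_one, Complex.Gamma_one_half_eq,
      ← Complex.cpow_add _ _ (by exact_mod_cast Real.pi_ne_zero)]
    norm_num
  have hs : ∀ x : ℝ, 0 ≤ x → (x : ℂ) ^ (-(1 / 2) : ℂ) = ((1 / √x : ℝ) : ℂ) := by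
    intro x hx
    rw [Real.sqrt_eq_rpow, one_div (x ^ _), ← Real.rpow_neg hx, Complex.ofReal_cpow hx]
    norm_num
  rw [lauricellaFD, hΓ, Complex.ofReal_mul, ← intervalIntegral.integral_ofReal]
  congr 1
  refine intervalIntegral.integral_congr fun u hu => ?_
  rw [uIcc_of_le zero_le_one] at hu
  have p1 := h₁ u hu
  have p2 := h₂ u hu
  have p3 := h₃ u hu
  have c1 : ((1 : ℂ) - w₁ * u) ^ (-(β : ℂ)) = (((1 - w₁ * u) ^ (-β) : ℝ) : ℂ) := by
    rw [Complex.ofReal_cpow p1.le]; push_cast; rfl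
  have c2 : ((1 : ℂ) - w₂ * u) ^ (-(1 / 2) : ℂ) = ((1 / √(1 - w₂ * u) : ℝ) : ℂ) := by
    rw [← hs _ p2.le]; push_cast; rfl
  have c3 : ((1 : ℂ) - w₃ * u) ^ (-(1 / 2) : ℂ) = ((1 / √(1 - w₃ * u) : ℝ) : ℂ) := by
    rw [← hs _ p3.le]; push_cast; rfl
  have c0 : ((1 : ℂ) - u) ^ (-(1 / 2) : ℂ) = ((1 / √(1 - u) : ℝ) : ℂ) := by
    rw [← hs _ (by linarith [hu.2])]; push_cast; rfl
  simp only [Fin.prod_univ_three, Matrix.cons_val_zero, Matrix.cons_val_one, Matrix.cons_val]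
  rw [show (1 / 2 - 1 : ℂ) = -(1 / 2) by norm_num,
    show (1 - 1 / 2 - 1 : ℂ) = -(1 / 2) by norm_num, hs u hu.1, c0, c1, c2, c3,
    ← Complex.ofReal_mul, ← Complex.ofReal_mul, ← Complex.ofReal_mul, ← Complex.ofReal_mul]
  congr 1
  field_simp

open Set in
theorem integral_combination_eq {w₁ w₂ w₃ r κ ν A B : ℝ}
    (h₁ : ∀ u ∈ Icc (0 : ℝ) 1, 0 < 1 - w₁ * u) (hr : ∀ u ∈ Icc (0 : ℝ) 1, 0 < 1 - r * u)
    (hκ : 0 < κ)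
    (hint : IntervalIntegrable (fun u => κ * (1 - r * u) / (√u * √(1 - u) *
        (1 - w₁ * u) ^ (1 / 4 : ℝ) * √(1 - w₂ * u) * √(1 - w₃ * u))) volume 0 1)
    (hAB : A - B = ν * κ) (hB : B * w₁ = -(ν * κ * r)) :
    A * (∫ u in (0 : ℝ)..1, (1 - w₁ * u) ^ (-(1 / 4) : ℝ) /
        (√u * √(1 - u) * √(1 - w₂ * u) * √(1 - w₃ * u))) -
      B * (∫ u in (0 : ℝ)..1, (1 - w₁ * u) ^ (-(-3 / 4) : ℝ) /
        (√u * √(1 - u) * √(1 - w₂ * u) * √(1 - w₃ * u))) =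
      ν * ∫ u in (0 : ℝ)..1, κ * (1 - r * u) / (√u * √(1 - u) *
        (1 - w₁ * u) ^ (1 / 4 : ℝ) * √(1 - w₂ * u) * √(1 - w₃ * u)) := by
  have hIcc : uIcc (0 : ℝ) 1 = Icc 0 1 := uIcc_of_le zero_le_one
  have hquarter : ∀ u ∈ Icc (0 : ℝ) 1,
      (1 - w₁ * u) ^ (-(1 / 4) : ℝ) = ((1 - w₁ * u) ^ (1 / 4 : ℝ))⁻¹ := fun u hu =>
    Real.rpow_neg (h₁ u hu).le _
  have hthree : ∀ u ∈ Icc (0 : ℝ) 1,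
      (1 - w₁ * u) ^ (-(-3 / 4) : ℝ) = (1 - w₁ * u) * (1 - w₁ * u) ^ (-(1 / 4) : ℝ) :=
    fun u hu => by
      rw [show (-(-3 / 4) : ℝ) = 1 + -(1 / 4) by norm_num, Real.rpow_add (h₁ u hu), Real.rpow_one]
  have hi1 : IntervalIntegrable (fun u => (1 - w₁ * u) ^ (-(1 / 4) : ℝ) /
      (√u * √(1 - u) * √(1 - w₂ * u) * √(1 - w₃ * u))) volume 0 1 := by
    refine (hint.mul_continuousOn (g := fun u => (κ * (1 - r * u))⁻¹) ?_).congr fun u hu => ?_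
    · rw [hIcc]
      exact ContinuousOn.inv₀ (by fun_prop) fun u hu => (mul_pos hκ (hr u hu)).ne'
    · have hu' : u ∈ Icc (0 : ℝ) 1 := hIcc ▸ uIoc_subset_uIcc hu
      have h := (mul_pos hκ (hr u hu')).ne'
      simp only [hquarter u hu']
      rw [div_mul_eq_mul_div, mul_inv_cancel₀ h]
      ring
  have hi2 : IntervalIntegrable (fun u => (1 - w₁ * u) ^ (-(-3 / 4) : ℝ) /
      (√u * √(1 - u) * √(1 - w₂ * u) * √(1 - w₃ * u))) volume 0 1 := by
    refine (hi1.mul_continuousOn (g := fun u => 1 - w₁ * u) (by fun_prop)).congr fun u hu => ?_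
    simp only [hthree u (hIcc ▸ uIoc_subset_uIcc hu)]
    ring
  rw [← intervalIntegral.integral_const_mul, ← intervalIntegral.integral_const_mul,
    ← intervalIntegral.integral_const_mul,
    ← intervalIntegral.integral_sub (hi1.const_mul A) (hi2.const_mul B)]
  refine intervalIntegral.integral_congr fun u hu => ?_
  rw [hIcc] at hu
  simp only [hthree u hu, hquarter u hu]
  have hnum : A - B * (1 - w₁ * u) = ν * (κ * (1 - r * u)) := by
    linear_combination hAB + u * hB
  rw [← mul_div_assoc ν, ← hnum]
  ring

theorem one_sub_mul_pos_of_lt_one {w u : ℝ} (hw : w < 1) (hu : u ∈ Set.Icc (0 : ℝ) 1) :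
    0 < 1 - w * u := by
  obtain h | h := hu.2.lt_or_eq
  · nlinarith [mul_nonneg hu.1 (sub_nonneg.2 hw.le)]
  · rw [h]; linarith

theorem neg_fifth_le_mul {c v : ℝ} (hc : -(1 / 5) ≤ c) (hv : 0 ≤ v) (hv1 : v ≤ 1) :
    -(1 / 5) ≤ c * v := by
  nlinarith

theorem genus4_coefficients {s A B : ℝ} (hs : s ^ 2 = 22) (hlo : 4.6904 < s) (hhi : s < 4.69042)
    (hA : A = 91 / (6 * (264 * (169 + 36 * s)) ^ ((1 : ℝ) / 4)))
    (hB : B = (113 - 20 * s) ^ ((3 : ℝ) / 4) / (2 * (3 : ℝ) ^ ((1 : ℝ) / 4) * √(176 + 38 * s))) :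
    B = (113 - 20 * s) / 91 * A ∧
      (4 / 3 : ℝ) ^ ((1 : ℝ) / 4) * √2 * ((473/9 - 397/36 * s) / √(1892/9 - 397/9 * s)) =
        (20 * s - 22) / 91 * A := by
  have hroot : ∀ x : ℝ, 0 ≤ x → (x ^ ((1 : ℝ) / 4)) ^ 4 = x := fun x hx => by
    rw [← Real.rpow_natCast, ← Real.rpow_mul hx]; norm_num
  have hsqrt : ∀ x : ℝ, 0 ≤ x → √x ^ 4 = x ^ 2 := fun x hx => by
    rw [show √x ^ 4 = (√x ^ 2) ^ 2 by ring, Real.sq_sqrt hx]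
  have h1 : 0 < 169 + 36 * s := by linarith
  have h2 : 0 < 113 - 20 * s := by linarith
  have h3 : 0 < 176 + 38 * s := by linarith
  have h4 : 0 < 473/9 - 397/36 * s := by linarith
  have h5 : 0 < 20 * s - 22 := by linarith
  have h6 : 0 < 1892/9 - 397/9 * s := by linarith
  have hA4 : A ^ 4 = 91 ^ 4 / (6 ^ 4 * (264 * (169 + 36 * s))) := by
    rw [hA, div_pow, mul_pow, hroot _ (by positivity)]
  have hB4 : B ^ 4 = (113 - 20 * s) ^ 3 / (2 ^ 4 * 3 * (176 + 38 * s) ^ 2) := by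
    rw [hB, div_pow, mul_pow, mul_pow, hroot _ (by norm_num), hsqrt _ h3.le,
      ← Real.rpow_natCast (_ ^ _), ← Real.rpow_mul h2.le]
    norm_num
  have hA0 : 0 ≤ A := by rw [hA]; positivity
  have hB0 : 0 ≤ B := by rw [hB]; positivity
  constructor
  · rw [← pow_left_inj₀ hB0 (by positivity) (four_ne_zero), mul_pow, hA4, hB4]
    field_simp
    grind
  · rw [← pow_left_inj₀ (by positivity) (by positivity) (four_ne_zero), mul_pow, mul_pow, div_pow,
      mul_pow, hA4, hroot _ (by norm_num), hsqrt _ h6.le, hsqrt _ zero_le_two]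
    field_simp
    grind

theorem genus4_value :
    (((4/3 : ℝ) ^ ((1:ℝ)/4) * ellipticK (1 / Real.sqrt 2) : ℝ) : ℂ) =
      ((91 * Real.pi / (6 * (264 * (169 + 36 * Real.sqrt 22)) ^ ((1:ℝ)/4)) : ℝ) : ℂ) *
          lauricellaFD 3 (1/2) ![1/4, 1/2, 1/2] 1
            ![((5/567) * (23 - 16 * Real.sqrt 22) : ℝ),
              ((1/2 - 17 / (8 * Real.sqrt 22)) : ℝ),
              ((16 * Real.sqrt 22 - 75) : ℝ)] -
        (((113 - 20 * Real.sqrt 22) ^ ((3:ℝ)/4) * Real.pi /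
            (2 * (3:ℝ) ^ ((1:ℝ)/4) * Real.sqrt (176 + 38 * Real.sqrt 22)) : ℝ) : ℂ) *
          lauricellaFD 3 (1/2) ![-3/4, 1/2, 1/2] 1
            ![((5/567) * (23 - 16 * Real.sqrt 22) : ℝ),
              ((1/2 - 17 / (8 * Real.sqrt 22)) : ℝ),
              ((16 * Real.sqrt 22 - 75) : ℝ)] := by
  have hs : √(22 : ℝ) ^ 2 = 22 := Real.sq_sqrt (by norm_num)
  have hlo : 4.6904 < √(22 : ℝ) := Real.lt_sqrt_of_sq_lt (by norm_num)
  have hhi : √(22 : ℝ) < 4.69042 := by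
    rw [Real.sqrt_lt' (by norm_num)]; norm_num
  generalize √(22 : ℝ) = s at *
  have hw₂ : 1/2 - 17 / (8 * s) = 1/2 - 17/176 * s := by
    field_simp
    linear_combination 272 * hs
  rw [hw₂]
  have h₁ : ∀ u ∈ Set.Icc (0 : ℝ) 1, 0 < 1 - (5/567) * (23 - 16 * s) * u := fun u hu =>
    one_sub_mul_pos_of_lt_one (by linarith) hu
  have h₂ : ∀ u ∈ Set.Icc (0 : ℝ) 1, 0 < 1 - (1/2 - 17/176 * s) * u := fun u hu =>
    one_sub_mul_pos_of_lt_one (by linarith) hu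
  have h₃ : ∀ u ∈ Set.Icc (0 : ℝ) 1, 0 < 1 - (16 * s - 75) * u := fun u hu =>
    one_sub_mul_pos_of_lt_one (by linarith) hu
  have hα : ∀ u ∈ Set.Icc (0 : ℝ) 1, 0 < 1 - (-9/14 + s/7) * u := fun u hu =>
    one_sub_mul_pos_of_lt_one (by linarith) hu
  have hr : ∀ u ∈ Set.Icc (0 : ℝ) 1, 0 < 1 - (5/6 - 5/33 * s) * u := fun u hu =>
    one_sub_mul_pos_of_lt_one (by linarith) hu
  have hL : ∀ u ∈ Set.Icc (0 : ℝ) 1,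
      0 < 1 + (-1519/108 + 323/108 * s) * u + (1993/756 - 425/756 * s) * u ^ 2 := fun u hu => by
    linarith [neg_fifth_le_mul (c := -1519/108 + 323/108 * s) (by linarith) hu.1 hu.2,
      neg_fifth_le_mul (c := 1993/756 - 425/756 * s) (by linarith) (pow_nonneg hu.1 2)
        (pow_le_one₀ hu.1 hu.2)]
  have hq : ∀ u ∈ Set.Icc (0 : ℝ) 1, 0 < 1 + (75967/6804 - 32731/13608 * s) * u +
      (-311233/15876 + 132781/31752 * s) * u ^ 2 + (9130201/777924 - 3893245/1555848 * s) * u ^ 3 +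
      (232469/333396 - 99125/666792 * s) * u ^ 4 := fun u hu => by
    linarith [neg_fifth_le_mul (c := 75967/6804 - 32731/13608 * s) (by linarith) hu.1 hu.2,
      neg_fifth_le_mul (c := -311233/15876 + 132781/31752 * s) (by linarith)
        (pow_nonneg hu.1 2) (pow_le_one₀ hu.1 hu.2),
      neg_fifth_le_mul (c := 9130201/777924 - 3893245/1555848 * s) (by linarith)
        (pow_nonneg hu.1 3) (pow_le_one₀ hu.1 hu.2),
      neg_fifth_le_mul (c := 232469/333396 - 99125/666792 * s) (by linarith)
        (pow_nonneg hu.1 4) (pow_le_one₀ hu.1 hu.2)]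
  have hκ₁ : 0 < 473/9 - 397/36 * s := by linarith
  have hκ₂ : 0 < 1892/9 - 397/9 * s := by linarith
  obtain ⟨hint, hval⟩ := ellipticK_inv_sqrt_two_eq_integral h₁ h₂ h₃ hα hr hL hq hκ₁ hκ₂
    (genus4_norm_identity s · hs) (genus4_logDeriv_identity s · hs)
  obtain ⟨hB, hν⟩ := genus4_coefficients hs hlo hhi rfl rfl
  have hcomb := integral_combination_eq h₁ hr (div_pos hκ₁ (Real.sqrt_pos.2 hκ₂)) hint
    (A := 91 / (6 * (264 * (169 + 36 * s)) ^ ((1 : ℝ) / 4)))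
    (B := (113 - 20 * s) ^ ((3 : ℝ) / 4) / (2 * (3 : ℝ) ^ ((1 : ℝ) / 4) * √(176 + 38 * s)))
    (ν := (4 / 3 : ℝ) ^ ((1 : ℝ) / 4) * √2) (by rw [hν, hB]; ring)
    (by
      rw [hν, hB]
      generalize (91 : ℝ) / (6 * (264 * (169 + 36 * s)) ^ ((1 : ℝ) / 4)) = A
      linear_combination (-(100 / 43659) * A) * hs)
  rw [hval] at hcomb
  have hF₁ := lauricellaFD_three_half_eq_integral (1 / 4) h₁ h₂ h₃
  have hF₂ := lauricellaFD_three_half_eq_integral (-3 / 4) h₁ h₂ h₃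
  rw [show (((1 / 4 : ℝ)) : ℂ) = 1 / 4 by norm_num] at hF₁
  rw [show (((-3 / 4 : ℝ)) : ℂ) = -3 / 4 by norm_num] at hF₂
  rw [hF₁, hF₂, ← Complex.ofReal_mul, ← Complex.ofReal_mul, ← Complex.ofReal_sub,
    Complex.ofReal_inj]
  have h2 : √(2 : ℝ) ≠ 0 := by positivity
  rw [show (4 / 3 : ℝ) ^ ((1 : ℝ) / 4) * ellipticK (1 / √2) =
    (4 / 3 : ℝ) ^ ((1 : ℝ) / 4) * √2 * (ellipticK (1 / √2) / √2) by field_simp, ← hcomb]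
  have hπ : ∀ a d I : ℝ, a * Real.pi / d * (1 / Real.pi * I) = a / d * I := fun a d I => by
    field_simp [Real.pi_ne_zero]
  rw [hπ, hπ]
end

section
/- Set w_1 = (5/567)(23 − 16√22), w_2 = 1/2 − 17/(8√22), w_3 = 16√22 − 75, and define L_1 = F_D^{(3)}(1/2; 1/4, 1/2, 1/2; 1 | w_1, w_2, w_3) and L_2 = F_D^{(3)}(1/2; −3/4, 1/2, 1/2; 1 | w_1, w_2, w_3). Then π = (12·√(22(9 + 2√22)) / (91·22^{1/4}·L_1 − L_2·√(21569√22 − 99440))) · K(1/√2). -/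
open MeasureTheory

/-! ### The covering of the lemniscatic curve

With `r = √22`, the map `u ↦ (1 - u)² Q⁴ / (B² D³ L⁴)` has degree ten, and `1` minus it is
`κ u E S² / (B² D³ L⁴)`. It pulls the holomorphic differential of the lemniscatic curve back to
`N D^(-1/4) (u (1 - u) E B)^(-1/2) du`. -/

namespace LemniscaticCover

noncomputable def D (r u : ℝ) : ℝ := 1 - ((5/567) * (23 - 16 * r)) * u

noncomputable def E (r u : ℝ) : ℝ := 1 - (1/2 - 17 * r / 176) * u

noncomputable def B (r u : ℝ) : ℝ := 1 - (16 * r - 75) * u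

noncomputable def Q (r u : ℝ) : ℝ :=
  1 + (-1519/108 + 323/108 * r) * u + (1993/756 - 425/756 * r) * u ^ 2

noncomputable def L (r u : ℝ) : ℝ := 1 + (9/14 - 1/7 * r) * u

noncomputable def S (r u : ℝ) : ℝ :=
  1 + (75967/6804 - 32731/13608 * r) * u + (-311233/15876 + 132781/31752 * r) * u ^ 2 +
    (9130201/777924 - 3893245/1555848 * r) * u ^ 3 + (232469/333396 - 99125/666792 * r) * u ^ 4

noncomputable def N (r u : ℝ) : ℝ := 91 - (113 - 20 * r) * D r u

lemma one_sub_cover {r : ℝ} (hr : r ^ 2 = 22) (u : ℝ) :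
    D r u ^ 3 * B r u ^ 2 * L r u ^ 4 - (1 - u) ^ 2 * Q r u ^ 4 =
      (5676/27 - 1191/27 * r) * u * E r u * S r u ^ 2 := by
  unfold D E B Q L S
  linear_combination (
      (-92231/99792)*u^2 + (-148236762043/339492384)*u^3 +
      (-3496966712329877/2395458261504)*u^4 + (18130817516187377/8384103915264)*u^5 +
      (-731497671053803585/352132364441088)*u^6 + (1419392101763142373/1437873821467776)*u^7 +
      (574861415132119397/5751495285871104)*u^8 + (-153357995816747789/1232463275543808)*u^9 +
      (-4988415493783/39125818271232)*u^10 + (972775882/10609137)*r*u^3 +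
      (13783579688621/21388020192)*r*u^4 + (-455914492665083/524006494704)*r*u^5 +
      (6168231166651469/7336090925856)*r*u^6 + (-16973889418655233/29955704613912)*r*u^7 +
      (-90075166251629/1556140499424)*r*u^8 + (2679212968887205/25676318240496)*r*u^9 +
      (18863290375/349337663136)*r*u^10 + (-48539429803339/684416646144)*r^2*u^4 +
      (16711932870821/217768932864)*r^2*u^5 + (-7031271013816703/100609246983168)*r^2*u^6 +
      (7428068589458945/58688727406848)*r^2*u^7 +
      (131877124314528925/11502990571742208)*r^2*u^8 +
      (-92097561123002125/2464926551087616)*r^2*u^9 +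
      (-447361109375/78251636542464)*r^2*u^10 + (35089520/15752961)*r^3*u^5 +
      (-1535019968/330812181)*r^3*u^6 + (-2313479615200/145888171821)*r^3*u^7 +
      (-70848548800/145888171821)*r^3*u^8 + (3511419626000/437664515463)*r^3*u^9 +
      (2767119872/8931928887)*r^4*u^6 + (26883837440/20841167403)*r^4*u^7 +
      (-9166835200/48629390607)*r^4*u^8 + (-539404480000/437664515463)*r^4*u^9 +
      (-6545121280/145888171821)*r^5*u^7 + (5305548800/145888171821)*r^5*u^8 +
      (60093440000/437664515463)*r^5*u^9 + (-99942400/48629390607)*r^6*u^8 +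
      (-1384448000/145888171821)*r^6*u^9 + (131072000/437664515463)*r^7*u^9) * hr

lemma logDeriv_cover {r : ℝ} (hr : r ^ 2 = 22) (u : ℝ) :
    -1/2 * (Q r u * B r u * D r u * L r u) +
      ((-1519/108 + 323/108 * r) + 2 * (1993/756 - 425/756 * r) * u) *
        ((1 - u) * B r u * D r u * L r u) +
      1/2 * (16 * r - 75) * ((1 - u) * Q r u * D r u * L r u) +
      3/4 * ((5/567) * (23 - 16 * r)) * ((1 - u) * Q r u * B r u * L r u) -
      (9/14 - 1/7 * r) * ((1 - u) * Q r u * B r u * D r u) =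
      -((-4/9 + 7/72 * r) * N r u * S r u) := by
  unfold N D B Q L S
  linear_combination (
      (35/18) + (10113347/489888)*u + (-34990701961/555532992)*u^2 +
      (120131818837/9073705536)*u^3 + (230546556977/63515938752)*u^4 +
      (813750235/27221116608)*u^5 + (-154055/34992)*r*u + (81730081/4960116)*r*u^2 +
      (-419786945/162030456)*r*u^3 + (-4593269045/3969746172)*r*u^4 +
      (-185937655/6805279152)*r*u^5 + (-818275/1240029)*r^2*u^2 + (-24125/413343)*r^2*u^3 +
      (11653835/141776649)*r^2*u^4 + (275875/60761421)*r^2*u^5) * hr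

section Positivity

variable {r u : ℝ}

lemma D_pos (h1 : 4.69041 < r) (h0 : 0 ≤ u) : 0 < D r u := by
  unfold D
  nlinarith [mul_nonneg (by linarith : (0:ℝ) ≤ 16 * r - 23) h0]

lemma E_pos (h1 : 4.69041 < r) (h0 : 0 ≤ u) (hu : u ≤ 1) : 0 < E r u := by
  unfold E
  nlinarith [mul_nonneg (by linarith : (0:ℝ) ≤ r - 4.69041) h0]

lemma B_pos (h2 : r < 4.69042) (h0 : 0 ≤ u) (hu : u ≤ 1) : 0 < B r u := by
  unfold B
  nlinarith [mul_nonneg (by linarith : (0:ℝ) ≤ 4.69042 - r) h0]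

lemma L_pos (h2 : r < 4.69042) (h0 : 0 ≤ u) (hu : u ≤ 1) : 0 < L r u := by
  unfold L
  nlinarith [mul_nonneg (by linarith : (0:ℝ) ≤ 4.69042 - r) h0]

lemma Q_pos (h1 : 4.69041 < r) (h2 : r < 4.69042) (h0 : 0 ≤ u) (hu : u ≤ 1) : 0 < Q r u := by
  have hu2 : u ^ 2 ≤ 1 := pow_le_one₀ h0 hu
  unfold Q
  nlinarith [mul_nonneg (by linarith : (0:ℝ) ≤ r - 4.69041) h0,
    mul_nonneg (by linarith : (0:ℝ) ≤ 4.69042 - r) (sq_nonneg u), sq_nonneg u]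

lemma S_pos (h1 : 4.69041 < r) (h2 : r < 4.69042) (h0 : 0 ≤ u) (hu : u ≤ 1) : 0 < S r u := by
  have hu2 : u ^ 2 ≤ 1 := pow_le_one₀ h0 hu
  have hu3 : u ^ 3 ≤ 1 := pow_le_one₀ h0 hu
  have hu4 : u ^ 4 ≤ 1 := pow_le_one₀ h0 hu
  have p2 : 0 ≤ u ^ 2 := by positivity
  have p3 : 0 ≤ u ^ 3 := by positivity
  have p4 : 0 ≤ u ^ 4 := by positivity
  unfold S
  nlinarith [mul_nonneg (by linarith : (0:ℝ) ≤ 4.69042 - r) h0,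
    mul_nonneg (by linarith : (0:ℝ) ≤ r - 4.69041) p2,
    mul_nonneg (by linarith : (0:ℝ) ≤ 4.69042 - r) p3,
    mul_nonneg (by linarith : (0:ℝ) ≤ 4.69042 - r) p4]

lemma N_pos (h1 : 4.69041 < r) (h2 : r < 4.69042) (h0 : 0 ≤ u) (hu : u ≤ 1) : 0 < N r u := by
  have hD : D r u ≤ 1.5 := by
    unfold D
    nlinarith [mul_nonneg (by linarith : (0:ℝ) ≤ 4.69042 - r) h0]
  have hD0 := D_pos h1 h0
  unfold N
  nlinarith [mul_nonneg (by linarith : (0:ℝ) ≤ r - 4.69041) hD0.le]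

end Positivity

/-- The fourth root of the covering map. -/
noncomputable def t (r u : ℝ) : ℝ :=
  (1 - u) ^ (1/2 : ℝ) * Q r u / (B r u ^ (1/2 : ℝ) * D r u ^ (3/4 : ℝ) * L r u)

/-- The common part of the integrands, with exponent `p` at the branch point of order four. -/
noncomputable def weight (r p u : ℝ) : ℝ :=
  u ^ (-(1/2) : ℝ) * (1 - u) ^ (-(1/2) : ℝ) *
    (D r u ^ p * E r u ^ (-(1/2) : ℝ) * B r u ^ (-(1/2) : ℝ))

lemma hasDerivAt_t {r u : ℝ} (hr : r ^ 2 = 22) (h1 : 4.69041 < r) (h2 : r < 4.69042)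
    (h0 : 0 < u) (hu : u < 1) :
    HasDerivAt (t r) (-(t r u * ((-4/9 + 7/72 * r) * N r u * S r u) /
      ((1 - u) * Q r u * B r u * D r u * L r u))) u := by
  have hA : 0 < 1 - u := by linarith
  have hB := B_pos h2 h0.le hu.le
  have hD := D_pos h1 h0.le
  have hL := L_pos h2 h0.le hu.le
  have hQ := Q_pos h1 h2 h0.le hu.le
  have dA : HasDerivAt (fun u : ℝ ↦ 1 - u) (-1) u := by
    simpa using (hasDerivAt_id u).const_sub 1
  have dlin (c : ℝ) : HasDerivAt (fun u : ℝ ↦ c * u) c u := by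
    simpa using (hasDerivAt_id u).const_mul c
  have dB : HasDerivAt (B r) (-(16 * r - 75)) u := (dlin _).const_sub 1
  have dD : HasDerivAt (D r) (-((5/567) * (23 - 16 * r))) u := (dlin _).const_sub 1
  have dL : HasDerivAt (L r) (9/14 - 1/7 * r) u := (dlin _).const_add 1
  have dQ : HasDerivAt (Q r)
      ((-1519/108 + 323/108 * r) + 2 * (1993/756 - 425/756 * r) * u) u := by
    have := ((dlin (-1519/108 + 323/108 * r)).const_add 1).add
      (((hasDerivAt_id u).pow 2).const_mul (1993/756 - 425/756 * r))
    refine this.congr_deriv ?_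
    simp
    ring
  have key := ((dA.rpow_const (p := 1/2) (Or.inl hA.ne')).mul dQ).div
    (((dB.rpow_const (p := 1/2) (Or.inl hB.ne')).mul
      (dD.rpow_const (p := 3/4) (Or.inl hD.ne'))).mul dL)
    (mul_pos (mul_pos (Real.rpow_pos_of_pos hB _) (Real.rpow_pos_of_pos hD _)) hL).ne'
  refine key.congr_deriv ?_
  have hlog := logDeriv_cover hr u
  have e : (-4/9 + 7/72 * r) * N r u * S r u = -(-1/2 * (Q r u * B r u * D r u * L r u) +
      ((-1519/108 + 323/108 * r) + 2 * (1993/756 - 425/756 * r) * u) *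
        ((1 - u) * B r u * D r u * L r u) +
      1/2 * (16 * r - 75) * ((1 - u) * Q r u * D r u * L r u) +
      3/4 * ((5/567) * (23 - 16 * r)) * ((1 - u) * Q r u * B r u * L r u) -
      (9/14 - 1/7 * r) * ((1 - u) * Q r u * B r u * D r u)) := by rw [hlog]; ring
  rw [e, Real.rpow_sub_one hA.ne', Real.rpow_sub_one hB.ne', Real.rpow_sub_one hD.ne']
  unfold t
  simp only [Pi.mul_apply]
  have a0 : 0 < (1 - u) ^ (1/2 : ℝ) := by positivity
  have b0 : 0 < B r u ^ (1/2 : ℝ) := by positivity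
  have d0 : 0 < D r u ^ (3/4 : ℝ) := by positivity
  generalize (1 - u) ^ (1/2 : ℝ) = a at *
  generalize B r u ^ (1/2 : ℝ) = b at *
  generalize D r u ^ (3/4 : ℝ) = d at *
  generalize hA' : 1 - u = A at *
  generalize B r u = B at *
  generalize D r u = D at *
  generalize L r u = L at *
  generalize Q r u = Q at *
  field_simp
  ring

lemma one_sub_t_pow {r u : ℝ} (hr : r ^ 2 = 22) (h1 : 4.69041 < r) (h2 : r < 4.69042)
    (h0 : 0 ≤ u) (hu : u ≤ 1) :
    1 - t r u ^ 4 = (5676/27 - 1191/27 * r) * u * E r u * S r u ^ 2 /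
      (D r u ^ 3 * B r u ^ 2 * L r u ^ 4) := by
  have hA : 0 ≤ 1 - u := by linarith
  have hB := B_pos h2 h0 hu
  have hD := D_pos h1 h0
  have hL := L_pos h2 h0 hu
  rw [← one_sub_cover hr u]
  have ea : ((1 - u) ^ (1/2 : ℝ)) ^ 4 = (1 - u) ^ 2 := by
    rw [← Real.rpow_natCast, ← Real.rpow_mul hA, ← Real.rpow_natCast]; norm_num
  have eb : (B r u ^ (1/2 : ℝ)) ^ 4 = B r u ^ 2 := by
    rw [← Real.rpow_natCast, ← Real.rpow_mul hB.le, ← Real.rpow_natCast]; norm_num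
  have ed : (D r u ^ (3/4 : ℝ)) ^ 4 = D r u ^ 3 := by
    rw [← Real.rpow_natCast, ← Real.rpow_mul hD.le, ← Real.rpow_natCast]; norm_num
  unfold t
  rw [div_pow, mul_pow, mul_pow, mul_pow, ea, eb, ed]
  field_simp

lemma t_nonneg {r u : ℝ} (h1 : 4.69041 < r) (h2 : r < 4.69042)
    (h0 : 0 ≤ u) (hu : u ≤ 1) : 0 ≤ t r u := by
  have hA : 0 ≤ 1 - u := by linarith
  have hB := B_pos h2 h0 hu
  have hD := D_pos h1 h0
  have hL := L_pos h2 h0 hu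
  have hQ := Q_pos h1 h2 h0 hu
  unfold t
  positivity

lemma continuousOn_t {r : ℝ} (h1 : 4.69041 < r) (h2 : r < 4.69042) :
    ContinuousOn (t r) (Set.Icc 0 1) := by
  have cB : Continuous (B r) := by unfold B; fun_prop
  have cD : Continuous (D r) := by unfold D; fun_prop
  have cL : Continuous (L r) := by unfold L; fun_prop
  have cQ : Continuous (Q r) := by unfold Q; fun_prop
  refine ContinuousOn.div (Continuous.continuousOn ?_) (Continuous.continuousOn ?_) ?_
  · exact ((continuous_const.sub continuous_id).rpow_const fun _ ↦ Or.inr (by norm_num)).mul cQ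
  · exact ((cB.rpow_const fun _ ↦ Or.inr (by norm_num)).mul
      (cD.rpow_const fun _ ↦ Or.inr (by norm_num))).mul cL
  · intro u hu
    have hB := B_pos h2 hu.1 hu.2
    have hD := D_pos h1 hu.1
    have hL := L_pos h2 hu.1 hu.2
    positivity

noncomputable def scale (r : ℝ) : ℝ := (12 * √(r * (9 + 2 * r)))⁻¹

lemma weight_sq {r u : ℝ} (h1 : 4.69041 < r) (h2 : r < 4.69042) (h0 : 0 < u) (hu : u < 1) :
    weight r (-(1/4)) u ^ 2 * (u * (1 - u) * √(D r u) * E r u * B r u) = 1 := by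
  have hA : 0 < 1 - u := by linarith
  have hB := B_pos h2 h0.le hu.le
  have hD := D_pos h1 h0.le
  have hE := E_pos h1 h0.le hu.le
  have e {x : ℝ} (hx : 0 < x) : (x ^ (-(1/2) : ℝ)) ^ 2 * x = 1 := by
    rw [← Real.rpow_natCast, ← Real.rpow_mul hx.le]
    norm_num
    rw [Real.rpow_neg_one, inv_mul_cancel₀ hx.ne']
  have e4 : (D r u ^ (-(1/4) : ℝ)) ^ 2 * √(D r u) = 1 := by
    rw [← Real.rpow_natCast, ← Real.rpow_mul hD.le, Real.sqrt_eq_rpow, ← Real.rpow_add hD]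
    norm_num
  unfold weight
  calc _ = ((u ^ (-(1/2) : ℝ)) ^ 2 * u) * (((1 - u) ^ (-(1/2) : ℝ)) ^ 2 * (1 - u)) *
        ((D r u ^ (-(1/4) : ℝ)) ^ 2 * √(D r u)) * ((E r u ^ (-(1/2) : ℝ)) ^ 2 * E r u) *
        ((B r u ^ (-(1/2) : ℝ)) ^ 2 * B r u) := by ring
    _ = 1 := by rw [e h0, e hA, e hE, e hB, e4]; norm_num

lemma t_sq {r u : ℝ} (h1 : 4.69041 < r) (h2 : r < 4.69042) (h0 : 0 < u) (hu : u < 1) :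
    t r u ^ 2 = (1 - u) * Q r u ^ 2 / (B r u * (D r u * √(D r u)) * L r u ^ 2) := by
  have hA : 0 ≤ 1 - u := by linarith
  have hB := B_pos h2 h0.le hu.le
  have hD := D_pos h1 h0.le
  have ed : (D r u ^ (3/4 : ℝ)) ^ 2 = D r u * √(D r u) := by
    rw [← Real.rpow_natCast, ← Real.rpow_mul hD.le, Real.sqrt_eq_rpow,
      ← Real.rpow_one_add' hD.le (by norm_num)]
    norm_num
  unfold t
  rw [div_pow, mul_pow, mul_pow, mul_pow, ed, ← Real.sqrt_eq_rpow, ← Real.sqrt_eq_rpow,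
    Real.sq_sqrt hA, Real.sq_sqrt hB.le]

lemma scale_sq {r : ℝ} (hr : r ^ 2 = 22) (h1 : 4.69041 < r) :
    scale r ^ 2 * (5676/27 - 1191/27 * r) = 2 * (-4/9 + 7/72 * r) ^ 2 := by
  have h : 0 < r * (9 + 2 * r) := by positivity
  unfold scale
  rw [inv_pow, mul_pow, Real.sq_sqrt h.le]
  field_simp
  linear_combination (-81 * 27 * 72 ^ 2 : ℝ) * (86/9 - 455/18 * r + 49/9 * r ^ 2) * hr

lemma pullback {r u : ℝ} (hr : r ^ 2 = 22) (h1 : 4.69041 < r) (h2 : r < 4.69042)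
    (h0 : 0 < u) (hu : u < 1) :
    (1 - (1 / √2) ^ 2 * Real.sin (Real.arccos (t r u)) ^ 2) ^ (-(1:ℝ)/2) *
      (-(1 / √(1 - t r u ^ 2)) * (-(t r u * ((-4/9 + 7/72 * r) * N r u * S r u) /
      ((1 - u) * Q r u * B r u * D r u * L r u)))) =
    scale r * (N r u * weight r (-(1/4)) u) := by
  have hA : 0 < 1 - u := by linarith
  have hB := B_pos h2 h0.le hu.le
  have hD := D_pos h1 h0.le
  have hL := L_pos h2 h0.le hu.le
  have hE := E_pos h1 h0.le hu.le
  have hQ := Q_pos h1 h2 h0.le hu.le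
  have hS := S_pos h1 h2 h0.le hu.le
  have hN := N_pos h1 h2 h0.le hu.le
  have ht := t_nonneg h1 h2 h0.le hu.le
  have hk : 0 < 5676/27 - 1191/27 * r := by linarith
  have hC : 0 < -4/9 + 7/72 * r := by linarith
  have h4 := one_sub_t_pow hr h1 h2 h0.le hu.le
  have h4pos : 0 < 1 - t r u ^ 4 := by rw [h4]; positivity
  have h2pos : 0 < 1 - t r u ^ 2 := by nlinarith [sq_nonneg (t r u)]
  have hs : 1 - (1 / √2) ^ 2 * Real.sin (Real.arccos (t r u)) ^ 2 = (1 + t r u ^ 2) / 2 := by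
    rw [Real.sin_arccos, Real.sq_sqrt h2pos.le, div_pow, Real.sq_sqrt (by norm_num)]
    ring
  rw [hs]
  have hsc : 0 ≤ scale r := by unfold scale; positivity
  have hw : 0 ≤ weight r (-(1/4)) u := by unfold weight; positivity
  rw [neg_mul_neg]
  refine (sq_eq_sq₀ (by positivity) (by positivity)).1 ?_
  have e1 : (((1 + t r u ^ 2) / 2) ^ (-(1:ℝ)/2)) ^ 2 = 2 / (1 + t r u ^ 2) := by
    rw [← Real.rpow_natCast, ← Real.rpow_mul (by positivity)]
    norm_num
    rw [Real.rpow_neg_one, inv_div]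
  have e2 : (1 / √(1 - t r u ^ 2)) ^ 2 = 1 / (1 - t r u ^ 2) := by
    rw [div_pow, Real.sq_sqrt h2pos.le, one_pow]
  have hw2 := weight_sq h1 h2 h0 hu
  have hd : 0 < √(D r u) := Real.sqrt_pos.2 hD
  have hd2 : √(D r u) ^ 2 = D r u := Real.sq_sqrt hD.le
  have hw2' : weight r (-(1/4)) u ^ 2 = 1 / (u * (1 - u) * √(D r u) * E r u * B r u) := by
    rw [eq_div_iff (by positivity)]; exact hw2
  have hsc2 : scale r ^ 2 = 2 * (-4/9 + 7/72 * r) ^ 2 / (5676/27 - 1191/27 * r) := by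
    rw [eq_div_iff hk.ne']; exact scale_sq hr h1
  have e3 : 2 / (1 + t r u ^ 2) * (1 / (1 - t r u ^ 2)) = 2 / (1 - t r u ^ 4) := by
    have : 1 - t r u ^ 4 = (1 + t r u ^ 2) * (1 - t r u ^ 2) := by ring
    rw [this]; field_simp
  rw [mul_pow, mul_pow, e1, e2, ← mul_assoc, e3, h4, div_pow, mul_pow (t r u),
    t_sq h1 h2 h0 hu, mul_pow (scale r), hsc2, mul_pow (N r u), hw2']
  generalize -4/9 + 7/72 * r = C at *
  generalize 5676/27 - 1191/27 * r = k at *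
  generalize 1 - u = A at *
  generalize √(D r u) = d at *
  rw [← hd2]
  field_simp

lemma integral_weight {r : ℝ} (hr : r ^ 2 = 22) (h1 : 4.69041 < r) (h2 : r < 4.69042) :
    IntervalIntegrable (fun u ↦ N r u * weight r (-(1/4)) u) volume 0 1 ∧
    scale r * ∫ u in (0:ℝ)..1, N r u * weight r (-(1/4)) u = ellipticK (1 / √2) := by
  have hpos (θ : ℝ) : 0 < 1 - (1 / √2) ^ 2 * Real.sin θ ^ 2 := by
    rw [div_pow, Real.sq_sqrt (by norm_num)]
    nlinarith [Real.sin_sq_le_one θ]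
  have cK : Continuous fun θ : ℝ ↦ (1 - (1 / √2) ^ 2 * Real.sin θ ^ 2) ^ (-(1:ℝ)/2) :=
    Continuous.rpow_const (by fun_prop) fun θ ↦ Or.inl (hpos θ).ne'
  have dK (θ : ℝ) := cK.integral_hasStrictDerivAt 0 θ |>.hasDerivAt
  set F : ℝ → ℝ := fun u ↦ ∫ θ in (0:ℝ)..Real.arccos (t r u),
    (1 - (1 / √2) ^ 2 * Real.sin θ ^ 2) ^ (-(1:ℝ)/2) with hF
  have cF : ContinuousOn F (Set.Icc 0 1) := by
    have c1 : Continuous fun x ↦ ∫ θ in (0:ℝ)..x,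
      (1 - (1 / √2) ^ 2 * Real.sin θ ^ 2) ^ (-(1:ℝ)/2) :=
      continuous_iff_continuousAt.2 fun x ↦ (dK x).continuousAt
    exact c1.comp_continuousOn (Real.continuous_arccos.comp_continuousOn (continuousOn_t h1 h2))
  have dF : ∀ u ∈ Set.Ioo (0:ℝ) 1,
      HasDerivAt F (scale r * (N r u * weight r (-(1/4)) u)) u := by
    intro u hu
    have hB := B_pos h2 hu.1.le hu.2.le
    have hD := D_pos h1 hu.1.le
    have hL := L_pos h2 hu.1.le hu.2.le
    have hE := E_pos h1 hu.1.le hu.2.le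
    have hS := S_pos h1 h2 hu.1.le hu.2.le
    have ht := t_nonneg h1 h2 hu.1.le hu.2.le
    have hk : 0 < 5676/27 - 1191/27 * r := by linarith
    have h4pos : 0 < 1 - t r u ^ 4 := by
      rw [one_sub_t_pow hr h1 h2 hu.1.le hu.2.le]
      have := hu.1
      positivity
    have ht1 : t r u < 1 := by
      by_contra! h
      linarith [one_le_pow₀ h (n := 4)]
    rw [← pullback hr h1 h2 hu.1 hu.2]
    exact (dK _).comp u ((Real.hasDerivAt_arccos (by linarith) ht1.ne).comp u
      (hasDerivAt_t hr h1 h2 hu.1 hu.2))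
  have hsc : 0 < scale r := by unfold scale; positivity
  have hnn : ∀ u ∈ Set.Ioo (0:ℝ) 1, 0 ≤ scale r * (N r u * weight r (-(1/4)) u) := by
    intro u hu
    have hA : 0 < 1 - u := by linarith [hu.2]
    have hu0 := hu.1
    have hB := B_pos h2 hu.1.le hu.2.le
    have hD := D_pos h1 hu.1.le
    have hE := E_pos h1 hu.1.le hu.2.le
    have hN := N_pos h1 h2 hu.1.le hu.2.le
    unfold weight
    positivity
  have hint : IntervalIntegrable (fun u ↦ scale r * (N r u * weight r (-(1/4)) u))
      volume 0 1 := by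
    rw [intervalIntegrable_iff_integrableOn_Ioc_of_le zero_le_one]
    exact intervalIntegral.integrableOn_deriv_of_nonneg cF dF hnn
  have hval := intervalIntegral.integral_eq_sub_of_hasDerivAt_of_le zero_le_one cF dF hint
  refine ⟨?_, ?_⟩
  · refine (hint.const_mul (scale r)⁻¹).congr fun u _ ↦ ?_
    exact inv_mul_cancel_left₀ hsc.ne' _
  · rw [← intervalIntegral.integral_const_mul, hval, hF]
    have t0 : t r 0 = 1 := by simp [t, Q, B, D, L]
    have t1 : t r 1 = 0 := by simp [t]
    simp [t0, t1, ellipticK]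

lemma ellipticK_pos : 0 < ellipticK (1 / √2) := by
  have hpos (θ : ℝ) : 0 < 1 - (1 / √2) ^ 2 * Real.sin θ ^ 2 := by
    rw [div_pow, Real.sq_sqrt (by norm_num)]
    nlinarith [Real.sin_sq_le_one θ]
  refine intervalIntegral.intervalIntegral_pos_of_pos ?_ (fun θ ↦ Real.rpow_pos_of_pos (hpos θ) _)
    (by positivity)
  exact (Continuous.rpow_const (by fun_prop) fun θ ↦ Or.inl (hpos θ).ne').intervalIntegrable _ _

end LemniscaticCover

lemma lauricellaFD_three_half_one (p x y z : ℝ) (hx : x ≤ 1) (hy : y ≤ 1) (hz : z ≤ 1) :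
    lauricellaFD 3 (1/2) ![(p : ℂ), 1/2, 1/2] 1 ![(x : ℂ), y, z] =
      ((Real.pi⁻¹ * ∫ u in (0:ℝ)..1, u ^ (-(1/2) : ℝ) * (1 - u) ^ (-(1/2) : ℝ) *
        ((1 - x * u) ^ (-p) * (1 - y * u) ^ (-(1/2) : ℝ) * (1 - z * u) ^ (-(1/2) : ℝ)) : ℝ) :
        ℂ) := by
  have hG : Complex.Gamma (1/2) * Complex.Gamma (1 - 1/2) = Real.pi := by
    rw [Complex.Gamma_mul_Gamma_one_sub]
    have : (Real.pi : ℂ) * (1/2) = Real.pi / 2 := by ring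
    rw [this, Complex.sin_pi_div_two, div_one]
  unfold lauricellaFD
  rw [hG, Complex.Gamma_one, Complex.ofReal_mul, Complex.ofReal_inv, one_div,
    ← intervalIntegral.integral_ofReal]
  congr 1
  refine intervalIntegral.integral_congr fun u hu ↦ ?_
  rw [Set.uIcc_of_le zero_le_one] at hu
  have key {w : ℝ} (hw : w ≤ 1) : 0 ≤ 1 - w * u := by nlinarith [hu.1, hu.2]
  have h1 : 0 ≤ 1 - u := by linarith [hu.2]
  have e1 : (1/2 - 1 : ℂ) = ((-(1/2) : ℝ) : ℂ) := by push_cast; ring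
  have e2 : (1 - 1/2 - 1 : ℂ) = ((-(1/2) : ℝ) : ℂ) := by push_cast; ring
  simp only [Fin.prod_univ_three, Matrix.cons_val_zero, Matrix.cons_val_one, Matrix.cons_val]
  rw [e1, e2]
  simp only [Complex.ofReal_mul]
  rw [Complex.ofReal_cpow hu.1, Complex.ofReal_cpow h1, Complex.ofReal_cpow (key hx),
    Complex.ofReal_cpow (key hy), Complex.ofReal_cpow (key hz)]
  push_cast
  norm_num

open LemniscaticCover in
lemma integral_weight_combination {r : ℝ} (hr : r ^ 2 = 22) (h1 : 4.69041 < r)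
    (h2 : r < 4.69042) :
    scale r * (91 * (∫ u in (0:ℝ)..1, weight r (-(1/4)) u) -
      (113 - 20 * r) * ∫ u in (0:ℝ)..1, weight r (3/4) u) = ellipticK (1 / √2) := by
  obtain ⟨hi, hv⟩ := integral_weight hr h1 h2
  have cD : Continuous (D r) := by unfold D; fun_prop
  have cN : Continuous (N r) := by unfold N; fun_prop
  have hw : IntervalIntegrable (weight r (-(1/4))) volume 0 1 := by
    have : ContinuousOn (fun u ↦ (N r u)⁻¹) (Set.uIcc 0 1) := by
      rw [Set.uIcc_of_le zero_le_one]
      exact cN.continuousOn.inv₀ fun u hu ↦ (N_pos h1 h2 hu.1 hu.2).ne'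
    refine (hi.continuousOn_mul this).congr fun u hu ↦ ?_
    rw [Set.uIoc_of_le zero_le_one] at hu
    exact inv_mul_cancel_left₀ (N_pos h1 h2 hu.1.le hu.2).ne' _
  have e : ∀ u ∈ Set.uIcc (0:ℝ) 1, weight r (3/4) u = D r u * weight r (-(1/4)) u := by
    intro u hu
    rw [Set.uIcc_of_le zero_le_one] at hu
    have hD := D_pos h1 hu.1
    have : D r u ^ (3/4 : ℝ) = D r u * D r u ^ (-(1/4) : ℝ) := by
      rw [← Real.rpow_one_add' hD.le (by norm_num)]; norm_num
    unfold weight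
    rw [this]; ring
  rw [intervalIntegral.integral_congr e, ← hv, ← intervalIntegral.integral_const_mul,
    ← intervalIntegral.integral_const_mul,
    ← intervalIntegral.integral_sub (hw.const_mul _)
      ((hw.continuousOn_mul cD.continuousOn).const_mul _)]
  congr 1
  refine intervalIntegral.integral_congr fun u _ ↦ ?_
  simp only [N]
  ring

open LemniscaticCover in
theorem pi_from_genus4 :
    (Real.pi : ℂ) =
      ((12 * Real.sqrt (22 * (9 + 2 * Real.sqrt 22)) : ℝ) : ℂ) /
          (91 * ((22:ℝ) ^ ((1:ℝ)/4) : ℝ) *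
              lauricellaFD 3 (1/2) ![1/4, 1/2, 1/2] 1
                ![((5/567) * (23 - 16 * Real.sqrt 22) : ℝ),
                  ((1/2 - 17 / (8 * Real.sqrt 22)) : ℝ),
                  ((16 * Real.sqrt 22 - 75) : ℝ)] -
            lauricellaFD 3 (1/2) ![-3/4, 1/2, 1/2] 1
                ![((5/567) * (23 - 16 * Real.sqrt 22) : ℝ),
                  ((1/2 - 17 / (8 * Real.sqrt 22)) : ℝ),
                  ((16 * Real.sqrt 22 - 75) : ℝ)] *
              (Real.sqrt (21569 * Real.sqrt 22 - 99440) : ℂ)) *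
        (ellipticK (1 / Real.sqrt 2) : ℂ) := by
  have hr : √22 ^ 2 = (22 : ℝ) := Real.sq_sqrt (by norm_num)
  have h1 : 4.69041 < √22 := Real.lt_sqrt_of_sq_lt (by norm_num)
  have h2 : √22 < 4.69042 := (Real.sqrt_lt' (by norm_num)).2 (by norm_num)
  have hcomb := integral_weight_combination hr h1 h2
  have hK := ellipticK_pos
  set r := √22 with hrdef
  have hr0 : 0 < r := by linarith
  have hw2 : 1/2 - 17 / (8 * r) = 1/2 - 17 * r / 176 := by
    field_simp
    linear_combination (272 : ℝ) * hr
  set q : ℝ := (22:ℝ) ^ ((1:ℝ)/4) with hq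
  have hq0 : 0 < q := by positivity
  have hq2 : q ^ 2 = r := by
    rw [hq, hrdef, Real.sqrt_eq_rpow, ← Real.rpow_natCast, ← Real.rpow_mul (by norm_num)]
    norm_num
  have hS : √(21569 * r - 99440) = q * (113 - 20 * r) := by
    rw [Real.sqrt_eq_iff_mul_self_eq_of_pos (by nlinarith)]
    linear_combination (113 - 20 * r) ^ 2 * hq2 + (400 * r - 4520) * hr
  have hnum : √(22 * (9 + 2 * r)) = q * √(r * (9 + 2 * r)) := by
    have h : 22 * (9 + 2 * r) = q ^ 2 * (r * (9 + 2 * r)) := by rw [hq2, ← hr]; ring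
    rw [h, Real.sqrt_mul (sq_nonneg q), Real.sqrt_sq hq0.le]
  have hL1 := lauricellaFD_three_half_one (1/4) ((5/567) * (23 - 16 * r)) (1/2 - 17 / (8 * r))
    (16 * r - 75) (by linarith) (by rw [hw2]; linarith) (by linarith)
  have hL2 := lauricellaFD_three_half_one (-3/4) ((5/567) * (23 - 16 * r)) (1/2 - 17 / (8 * r))
    (16 * r - 75) (by linarith) (by rw [hw2]; linarith) (by linarith)
  have c1 : (((1/4 : ℝ)) : ℂ) = 1/4 := by push_cast; rfl
  have c2 : (((-3/4 : ℝ)) : ℂ) = -3/4 := by push_cast; rfl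
  rw [c1] at hL1
  rw [c2] at hL2
  rw [hL1, hL2, hS, hnum, hw2]
  have hneg : (-(-3/4) : ℝ) = 3/4 := by norm_num
  rw [hneg]
  simp only [weight, D, E, B, scale] at hcomb
  generalize (∫ u in (0:ℝ)..1, u ^ (-(1/2) : ℝ) * (1 - u) ^ (-(1/2) : ℝ) *
    ((1 - (5/567) * (23 - 16 * r) * u) ^ (-(1/4) : ℝ) *
      (1 - (1/2 - 17 * r / 176) * u) ^ (-(1/2) : ℝ) *
      (1 - (16 * r - 75) * u) ^ (-(1/2) : ℝ))) = I₁ at *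
  generalize (∫ u in (0:ℝ)..1, u ^ (-(1/2) : ℝ) * (1 - u) ^ (-(1/2) : ℝ) *
    ((1 - (5/567) * (23 - 16 * r) * u) ^ (3/4 : ℝ) *
      (1 - (1/2 - 17 * r / 176) * u) ^ (-(1/2) : ℝ) *
      (1 - (16 * r - 75) * u) ^ (-(1/2) : ℝ))) = I₂ at *
  generalize ellipticK (1 / √2) = K at *
  have hs : 0 < √(r * (9 + 2 * r)) := Real.sqrt_pos.2 (by positivity)
  generalize √(r * (9 + 2 * r)) = s at *
  have hreal : Real.pi = 12 * (q * s) / (91 * q * (Real.pi⁻¹ * I₁) -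
      Real.pi⁻¹ * I₂ * (q * (113 - 20 * r))) * K := by
    have hd : 91 * I₁ - (113 - 20 * r) * I₂ = 12 * s * K := by
      rw [← hcomb]; field_simp
    have : 91 * q * (Real.pi⁻¹ * I₁) - Real.pi⁻¹ * I₂ * (q * (113 - 20 * r)) =
        Real.pi⁻¹ * q * (12 * s * K) := by rw [← hd]; ring
    rw [this]
    have := Real.pi_pos
    field_simp
  exact_mod_cast congrArg (Complex.ofReal) hreal
end
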